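/- arXiv:1508.02734 — 2 statements merged into one kernel-verified Lean document; each statement's English description precedes it below -/
import Mathlib

section
/- Let Ω ⊂ ℝ² be open and connected, and let f be a nonconstant solution on Ω of the homogeneous quasilinear elliptic equation a₁₁f_xx + 2a₁₂f_xy + a₂₂f_yy + b₁f_x + b₂f_y = 0, where the coefficients a₁₁, a₁₂, a₂₂, b₁, b₂ are real-analytic functions of (x,y) on Ω and the ellipticity conditions a₁₁ > 0 and a₁₂² < a₁₁a₂₂ hold on Ω. Then every critical point of f in Ω (a point where ∇f = 0) is an isolated critical point. -/
open Real Set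

/-- First partial derivative (in the x-direction) of `f : ℝ × ℝ → ℝ`. -/
noncomputable def pd1 (f : ℝ × ℝ → ℝ) (x : ℝ × ℝ) : ℝ := fderiv ℝ f x (1, 0)

/-- Second partial derivative (in the y-direction) of `f : ℝ × ℝ → ℝ`. -/
noncomputable def pd2 (f : ℝ × ℝ → ℝ) (x : ℝ × ℝ) : ℝ := fderiv ℝ f x (0, 1)

section
open MeasureTheory Metric Filter Topology

/-- Twice the Wirtinger operator `∂/∂z̄`. -/
noncomputable def dbar (h : ℂ → ℂ) (z : ℂ) : ℂ :=
  fderiv ℝ h z 1 + Complex.I * fderiv ℝ h z Complex.I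

theorem integrableOn_polar_strip {E : Type*} [NormedAddCommGroup E] {φ : ℝ × ℝ → E} {R : ℝ}
    (hφ : Continuous φ) (h0 : ∀ p : ℝ × ℝ, R < p.1 → φ p = 0) :
    IntegrableOn φ (Ioi 0 ×ˢ Ioo (-π) π) := by
  have h1 : IntegrableOn φ (Icc 0 R ×ˢ Icc (-π) π) :=
    hφ.continuousOn.integrableOn_compact (isCompact_Icc.prod isCompact_Icc)
  refine h1.of_forall_sdiff_eq_zero (by measurability) ?_
  rintro p ⟨⟨hp1, hp2⟩, hp3⟩
  apply h0
  by_contra! h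
  exact hp3 ⟨⟨le_of_lt hp1, h⟩, Ioo_subset_Icc_self hp2⟩

theorem integral_inv_mul_dbar {h : ℂ → ℂ} (hh : ContDiff ℝ 1 h) (hc : HasCompactSupport h) (z : ℂ) :
    ∫ u, u⁻¹ * dbar h (z - u) = 2 * π * h z := by
  set e : ℝ → ℂ := fun θ => (Real.cos θ : ℂ) + Real.sin θ * Complex.I with he
  have hee : Continuous e := by fun_prop
  have hdh : Continuous (fderiv ℝ h) := hh.continuous_fderiv one_ne_zero
  obtain ⟨R, hR⟩ : ∃ R : ℝ, ∀ u, R < ‖u‖ → fderiv ℝ h (z - u) = 0 := by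
    obtain ⟨R, hR⟩ := (hc.fderiv (𝕜 := ℝ)).isBounded.subset_closedBall z
    refine ⟨R, fun u hu => image_eq_zero_of_notMem_tsupport fun hmem => ?_⟩
    have := hR hmem
    simp at this
    linarith
  have hnorm : ∀ θ, ‖e θ‖ = 1 := by
    intro θ
    have := Complex.norm_exp_ofReal_mul_I θ
    rwa [Complex.exp_mul_I, ← Complex.ofReal_cos, ← Complex.ofReal_sin] at this
  have hcomp : ∀ p : ℝ × ℝ, R < p.1 → fderiv ℝ h (z - p.1 * e p.2) = 0 := by
    intro p hp
    apply hR
    rw [norm_mul, hnorm, mul_one, Complex.norm_real]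
    exact hp.trans_le (le_abs_self _)
  set φ₁ : ℝ × ℝ → ℂ := fun p => fderiv ℝ h (z - p.1 * e p.2) (e p.2) with hφ₁
  set φ₂ : ℝ × ℝ → ℂ := fun p => fderiv ℝ h (z - p.1 * e p.2) (Complex.I * e p.2) with hφ₂
  have c0 : Continuous fun p : ℝ × ℝ => fderiv ℝ h (z - p.1 * e p.2) := hdh.comp (by fun_prop)
  have c1 : Continuous φ₁ := c0.clm_apply (by fun_prop)
  have c2 : Continuous φ₂ := c0.clm_apply (by fun_prop)
  have i1 : IntegrableOn φ₁ (Ioi 0 ×ˢ Ioo (-π) π) :=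
    integrableOn_polar_strip (R := R) c1 fun p hp => by simp [hφ₁, hcomp p hp]
  have i2 : IntegrableOn φ₂ (Ioi 0 ×ˢ Ioo (-π) π) :=
    integrableOn_polar_strip (R := R) c2 fun p hp => by simp [hφ₂, hcomp p hp]
  have key : ∫ u, u⁻¹ * dbar h (z - u) = ∫ p in Ioi 0 ×ˢ Ioo (-π) π, φ₁ p + Complex.I * φ₂ p := by
    rw [← Complex.integral_comp_polarCoord_symm]
    refine setIntegral_congr_fun (by rw [polarCoord_target]; measurability) ?_
    rintro p ⟨hp1, hp2⟩
    have hp0 : (p.1 : ℂ) ≠ 0 := by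
      have : (0:ℝ) < p.1 := hp1
      exact_mod_cast this.ne'
    have hdec : ∀ (L : ℂ →L[ℝ] ℂ) (a b : ℝ), L (a + b * Complex.I) = a * L 1 + b * L Complex.I := by
      intro L a b
      have : (a + b * Complex.I : ℂ) = a • (1 : ℂ) + b • Complex.I := by simp
      rw [this, map_add, map_smul, map_smul]; simp
    have e1 : e p.2 * ((Real.cos p.2 : ℂ) - Real.sin p.2 * Complex.I) = 1 := by
      have : (Real.sin p.2 : ℂ) ^ 2 + (Real.cos p.2 : ℂ) ^ 2 = 1 := by
        exact_mod_cast Real.sin_sq_add_cos_sq p.2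
      simp only [he]
      linear_combination this - (Real.sin p.2 : ℂ) ^ 2 * Complex.I_sq
    have e2 : (e p.2)⁻¹ = (Real.cos p.2 : ℂ) - Real.sin p.2 * Complex.I :=
      inv_eq_of_mul_eq_one_right e1
    have e3 : Complex.I * e p.2 = ((-Real.sin p.2 : ℝ) : ℂ) + (Real.cos p.2 : ℝ) * Complex.I := by
      simp only [he, Complex.ofReal_neg]
      linear_combination (Real.sin p.2 : ℂ) * Complex.I_sq
    simp only [Complex.polarCoord_symm_apply, dbar, hφ₁, hφ₂, e3]
    rw [hdec, show ((Real.cos p.2 : ℂ) + Real.sin p.2 * Complex.I) = e p.2 from rfl, mul_inv, e2]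
    simp only [he, hdec]
    rw [Complex.real_smul]
    simp only [Complex.ofReal_neg]
    field_simp
    linear_combination (-(Real.sin p.2 : ℂ) *
      (fderiv ℝ h (z - p.1 * ((Real.cos p.2 : ℂ) + Real.sin p.2 * Complex.I)) Complex.I)) *
        Complex.I_sq
  have hder : ∀ r θ, HasDerivAt (fun r : ℝ => h (z - r * e θ)) (-φ₁ (r, θ)) r := by
    intro r θ
    have h1 : HasDerivAt (fun r : ℝ => z - r * e θ) (-e θ) r := by
      simpa using ((Complex.ofRealCLM.hasDerivAt (x := r)).mul_const (e θ)).const_sub z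
    have := ((hh.differentiable one_ne_zero) (z - r * e θ)).hasFDerivAt.comp_hasDerivAt r h1
    rw [map_neg] at this
    exact this
  have hder2 : ∀ (r θ : ℝ), HasDerivAt (fun θ : ℝ => h (z - r * e θ)) (-(r • φ₂ (r, θ))) θ := by
    intro r θ
    have h0 : HasDerivAt e (Complex.I * e θ) θ := by
      have := ((Real.hasDerivAt_cos θ).ofReal_comp).add
        (((Real.hasDerivAt_sin θ).ofReal_comp).mul_const Complex.I)
      convert! this using 1
      simp only [he, Complex.ofReal_neg]
      linear_combination (Real.sin θ : ℂ) * Complex.I_sq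
    have h1 : HasDerivAt (fun θ : ℝ => z - r * e θ) (-(r • (Complex.I * e θ))) θ := by
      simpa using (h0.const_mul (r : ℂ)).const_sub z
    have := ((hh.differentiable one_ne_zero) (z - r * e θ)).hasFDerivAt.comp_hasDerivAt θ h1
    rw [map_neg, map_smul] at this
    exact this
  have I1 : ∫ p in Ioi 0 ×ˢ Ioo (-π) π, φ₁ p = 2 * π * h z := by
    rw [Measure.volume_eq_prod] at i1 ⊢
    rw [setIntegral_prod _ i1, integral_integral_swap]
    · have : ∀ θ, ∫ r in Ioi (0:ℝ), φ₁ (r, θ) = h z := by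
        intro θ
        have hsupp : ∀ r : ℝ, R < r → φ₁ (r, θ) = 0 := fun r hr => by simp [hφ₁, hcomp (r, θ) hr]
        have hlim : Tendsto (fun r : ℝ => -h (z - r * e θ)) atTop (𝓝 0) := by
          obtain ⟨R', hR'⟩ := hc.isBounded.subset_closedBall z
          refine tendsto_const_nhds.congr' ?_
          filter_upwards [eventually_gt_atTop R', eventually_gt_atTop 0] with r hr hr0
          have h0 : h (z - r * e θ) = 0 := image_eq_zero_of_notMem_tsupport fun hm => by
            have := hR' hm
            simp [hnorm, abs_of_pos hr0] at this
            linarith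
          rw [h0, neg_zero]
        have hint : IntegrableOn (fun r => φ₁ (r, θ)) (Ioi 0) := by
          have h1 : IntegrableOn (fun r => φ₁ (r, θ)) (Icc 0 R) :=
            (c1.comp (by fun_prop :
              Continuous fun r : ℝ => (r, θ))).continuousOn.integrableOn_compact
              isCompact_Icc
          refine h1.of_forall_sdiff_eq_zero measurableSet_Ioi ?_
          rintro r ⟨hr, hr2⟩
          apply hsupp
          by_contra! hh
          exact hr2 ⟨le_of_lt hr, hh⟩
        have := integral_Ioi_of_hasDerivAt_of_tendsto' (a := (0:ℝ))
          (f := fun r : ℝ => -h (z - r * e θ))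
          (f' := fun r => φ₁ (r, θ)) (m := 0)
          (fun r _ => (neg_neg (φ₁ (r, θ))) ▸ (hder r θ).neg) hint hlim
        simpa using this
      simp only [this]
      rw [setIntegral_const, measureReal_def, Real.volume_Ioo,
        ENNReal.toReal_ofReal (by linarith [Real.pi_pos]), Complex.real_smul]
      push_cast
      ring
    · rw [Measure.prod_restrict]; exact i1
  have I2 : ∫ p in Ioi 0 ×ˢ Ioo (-π) π, φ₂ p = 0 := by
    rw [Measure.volume_eq_prod] at i2 ⊢
    rw [setIntegral_prod _ i2]
    rw [setIntegral_congr_fun (g := fun _ => 0) measurableSet_Ioi, integral_zero]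
    intro r hr
    have hr0 : r ≠ 0 := ne_of_gt hr
    have h1 : ∫ θ in (-π)..π, -(r • φ₂ (r, θ)) = 0 := by
      rw [intervalIntegral.integral_eq_sub_of_hasDerivAt (fun θ _ => hder2 r θ)]
      · simp [he]
      · exact (Continuous.neg (((c2.comp (by fun_prop : Continuous fun θ : ℝ => (r, θ)))).const_smul
          r)).intervalIntegrable _ _
    rw [intervalIntegral.integral_neg, intervalIntegral.integral_smul, neg_eq_zero,
      intervalIntegral.integral_of_le (by linarith [Real.pi_pos]),
      integral_Ioc_eq_integral_Ioo] at h1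
    exact (smul_eq_zero.1 h1).resolve_left hr0
  rw [key, integral_add i1 (i2.const_mul _), I1, integral_const_mul, I2]
  simp

/-- The Cauchy transform of `h`, normalised to be a right inverse of `dbar`. -/
noncomputable def cauchyTransform (h : ℂ → ℂ) (z : ℂ) : ℂ :=
  (2 * π : ℂ)⁻¹ * ∫ u, u⁻¹ * h (z - u)

theorem locallyIntegrable_inv : LocallyIntegrable (fun u : ℂ => u⁻¹) := by
  refine locallyIntegrable_of_norm_le_rpow (C := 1) (α := 1)
    (by simp [Complex.finrank_real_complex])
    (by simp [Complex.finrank_real_complex]) (Eventually.of_forall fun u => ?_)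
    (by fun_prop)
  rw [norm_inv, one_mul, rpow_neg_one]

theorem cauchyTransform_eq_convolution (h : ℂ → ℂ) :
    cauchyTransform h = fun z => (2 * π : ℂ)⁻¹ *
      convolution (fun u : ℂ => u⁻¹) h (ContinuousLinearMap.mul ℝ ℂ) volume z := rfl

theorem contDiff_cauchyTransform {h : ℂ → ℂ} (hh : ContDiff ℝ 1 h) (hc : HasCompactSupport h) :
    ContDiff ℝ 1 (cauchyTransform h) := by
  rw [cauchyTransform_eq_convolution]
  exact contDiff_const.mul (hc.contDiff_convolution_right _ locallyIntegrable_inv hh)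

theorem dbar_cauchyTransform {h : ℂ → ℂ} (hh : ContDiff ℝ 1 h) (hc : HasCompactSupport h) (z : ℂ) :
    dbar (cauchyTransform h) z = h z := by
  have h1 := (hc.hasFDerivAt_convolution_right (ContinuousLinearMap.mul ℝ ℂ)
    locallyIntegrable_inv hh z).const_mul ((2 * π : ℂ)⁻¹)
  have h2 : ∀ v : ℂ, fderiv ℝ (cauchyTransform h) z v =
      (2 * π : ℂ)⁻¹ * ∫ u, u⁻¹ * fderiv ℝ h (z - u) v := by
    intro v
    rw [cauchyTransform_eq_convolution, h1.fderiv, smul_apply,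
      convolution_precompR_apply _ locallyIntegrable_inv (hc.fderiv ℝ)
        (hh.continuous_fderiv one_ne_zero)]
    rfl
  have hi : ∀ v : ℂ, Integrable fun u : ℂ => u⁻¹ * fderiv ℝ h (z - u) v := fun v =>
    (HasCompactSupport.convolutionExists_right (ContinuousLinearMap.mul ℝ ℂ)
      (g := fun a => fderiv ℝ h a v)
        ((hc.fderiv ℝ).comp_left (g := fun L : ℂ →L[ℝ] ℂ => L v) (by simp))
      locallyIntegrable_inv ((hh.continuous_fderiv one_ne_zero).clm_apply continuous_const) z)
  have hpi : (2 * π : ℂ) ≠ 0 := by simp [Real.pi_ne_zero]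
  have h3 := integral_inv_mul_dbar hh hc z
  have h4 : ∫ u, u⁻¹ * dbar h (z - u) = (∫ u, u⁻¹ * fderiv ℝ h (z - u) 1) +
      Complex.I * ∫ u, u⁻¹ * fderiv ℝ h (z - u) Complex.I := by
    rw [← integral_const_mul, ← integral_add (hi 1) ((hi Complex.I).const_mul _)]
    congr 1; ext u; simp only [dbar]; ring
  rw [dbar, h2, h2]
  rw [show ∀ a b c : ℂ, a * b + Complex.I * (a * c) = a * (b + Complex.I * c) by intros; ring,
    ← h4, h3, inv_mul_cancel_left₀ hpi]

theorem norm_cauchyTransform_le {h : ℂ → ℂ} (hh : Continuous h) (hc : HasCompactSupport h)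
    {M δ : ℝ} (hδ : 0 < δ) (hM : ∀ u, ‖h u‖ ≤ M) (z : ℂ) :
    ‖cauchyTransform h z‖ ≤ M * (∫ u in ball (0 : ℂ) δ, ‖u⁻¹‖) + δ⁻¹ * ∫ u, ‖h u‖ := by
  have hi : Integrable fun u : ℂ => u⁻¹ * h (z - u) :=
    hc.convolutionExists_right (ContinuousLinearMap.mul ℝ ℂ) locallyIntegrable_inv hh z
  have hK : IntegrableOn (fun u : ℂ => ‖u⁻¹‖) (ball (0 : ℂ) δ) :=
    ((locallyIntegrable_inv.integrableOn_isCompact (isCompact_closedBall 0 δ)).mono_set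
      ball_subset_closedBall).norm
  have hhi : Integrable fun u => ‖h (z - u)‖ :=
    ((hh.integrable_of_hasCompactSupport hc).comp_sub_left z).norm
  have h1 : ‖cauchyTransform h z‖ ≤ ‖∫ u, u⁻¹ * h (z - u)‖ := by
    rw [cauchyTransform, norm_mul]
    refine mul_le_of_le_one_left (norm_nonneg _) ?_
    rw [norm_inv]
    apply inv_le_one_of_one_le₀
    simp [abs_of_pos Real.pi_pos]
    linarith [Real.pi_gt_three]
  refine h1.trans ((norm_integral_le_integral_norm _).trans ?_)
  rw [← integral_add_compl (measurableSet_ball (x := (0:ℂ)) (ε := δ)) hi.norm]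
  refine add_le_add ?_ ?_
  · rw [← integral_const_mul]
    refine setIntegral_mono hi.norm.integrableOn (hK.const_mul M) fun u => ?_
    rw [norm_mul, mul_comm]
    gcongr
    exact hM _
  · calc ∫ u in (ball (0 : ℂ) δ)ᶜ, ‖u⁻¹ * h (z - u)‖
        ≤ ∫ u in (ball (0 : ℂ) δ)ᶜ, δ⁻¹ * ‖h (z - u)‖ := by
          refine setIntegral_mono_on hi.norm.integrableOn (hhi.const_mul _).integrableOn
            measurableSet_ball.compl fun u hu => ?_
          rw [norm_mul, norm_inv]
          gcongr
          simpa using hu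
      _ ≤ ∫ u, δ⁻¹ * ‖h (z - u)‖ :=
          setIntegral_le_integral (hhi.const_mul _) (Eventually.of_forall fun u => by positivity)
      _ = δ⁻¹ * ∫ u, ‖h u‖ := by
          rw [integral_const_mul, integral_sub_left_eq_self (fun u => ‖h u‖)]

theorem tendsto_integral_ball_norm_inv :
    Tendsto (fun δ : ℝ => ∫ u in ball (0 : ℂ) δ, ‖u⁻¹‖) (𝓝[>] 0) (𝓝 0) := by
  have hK : IntegrableOn (fun u : ℂ => ‖u⁻¹‖) (ball (0 : ℂ) 1) :=
    ((locallyIntegrable_inv.integrableOn_isCompact (isCompact_closedBall 0 1)).mono_set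
      ball_subset_closedBall).norm
  have hvol : Tendsto (fun δ : ℝ => (volume.restrict (ball (0:ℂ) 1)) (ball (0 : ℂ) δ))
      (𝓝[>] 0) (𝓝 0) := by
    have h0 : Tendsto (fun δ : ℝ => ENNReal.ofReal δ ^ 2 * (NNReal.pi : ENNReal))
        (𝓝[>] 0) (𝓝 0) := by
      have : Tendsto (fun δ : ℝ => ENNReal.ofReal δ ^ 2 * (NNReal.pi : ENNReal)) (𝓝 0)
          (𝓝 (ENNReal.ofReal 0 ^ 2 * (NNReal.pi : ENNReal))) :=
        ENNReal.Tendsto.mul_const (((ENNReal.continuous_pow 2).tendsto _).comp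
          (ENNReal.continuous_ofReal.tendsto 0)) (Or.inr (by simp))
      simpa using this.mono_left nhdsWithin_le_nhds
    refine tendsto_of_tendsto_of_tendsto_of_le_of_le tendsto_const_nhds h0
      (fun _ => zero_le) fun δ => ?_
    refine (Measure.restrict_apply_le _ _).trans ?_
    rw [Complex.volume_ball]
  have := Integrable.tendsto_setIntegral_nhds_zero hK hvol
  refine this.congr' ?_
  filter_upwards [Ioo_mem_nhdsGT one_pos] with δ hδ
  rw [Measure.restrict_restrict measurableSet_ball, inter_eq_left.2 (ball_subset_ball hδ.2.le)]

theorem norm_cauchyTransform_le_of_support {h : ℂ → ℂ} (hh : Continuous h) {c : ℂ} {r M : ℝ}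
    (hM : ∀ u, ‖h u‖ ≤ M) (hs : ∀ u ∉ closedBall c r, h u = 0) (z : ℂ) :
    ‖cauchyTransform h z‖ ≤
      M * ((∫ u in ball (0 : ℂ) 1, ‖u⁻¹‖) + volume.real (closedBall c r)) := by
  have hc : HasCompactSupport h := HasCompactSupport.intro (isCompact_closedBall c r) hs
  refine (norm_cauchyTransform_le hh hc one_pos hM z).trans ?_
  rw [mul_add, inv_one, one_mul]
  gcongr
  rw [← setIntegral_eq_integral_of_forall_compl_eq_zero (s := closedBall c r)
    fun u hu => by rw [hs u hu, norm_zero]]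
  refine (le_abs_self _).trans ?_
  have hv : volume (closedBall c r) < ⊤ := measure_closedBall_lt_top
  exact norm_setIntegral_le_of_norm_le_const (f := fun u => ‖h u‖) hv
    fun u _ => by rw [norm_norm]; exact hM u

theorem cauchyTransform_sub {h k : ℂ → ℂ} (hh : Continuous h) (hc : HasCompactSupport h)
    (hk : Continuous k) (kc : HasCompactSupport k) (z : ℂ) :
    cauchyTransform (fun u => h u - k u) z = cauchyTransform h z - cauchyTransform k z := by
  have h1 := hc.convolutionExists_right (ContinuousLinearMap.mul ℝ ℂ) locallyIntegrable_inv hh z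
  have h2 := kc.convolutionExists_right (ContinuousLinearMap.mul ℝ ℂ) locallyIntegrable_inv hk z
  simp only [cauchyTransform]
  rw [← mul_sub]
  erw [← integral_sub h1 h2]
  simp [mul_sub]

/-- Cauchy transforms of a bounded pointwise convergent sequence converge uniformly. -/
theorem exists_tendstoUniformly_cauchyTransform {h : ℕ → ℂ → ℂ} {g : ℂ → ℂ} {c : ℂ} {r M : ℝ}
    (hh : ∀ n, Continuous (h n)) (hM : ∀ n u, ‖h n u‖ ≤ M)
    (hs : ∀ n, ∀ u ∉ closedBall c r, h n u = 0)
    (hg : ∀ u, Tendsto (fun n => h n u) atTop (𝓝 (g u))) :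
    ∃ s : ℂ → ℂ, TendstoUniformly (fun n => cauchyTransform (h n)) s atTop := by
  have hc : ∀ n, HasCompactSupport (h n) := fun n =>
    HasCompactSupport.intro (isCompact_closedBall c r) (hs n)
  have hgm : AEStronglyMeasurable g volume :=
    aestronglyMeasurable_of_tendsto_ae atTop (fun n => (hh n).aestronglyMeasurable)
      (Eventually.of_forall hg)
  have hM0 : 0 ≤ M := (norm_nonneg _).trans (hM 0 0)
  have hgM : ∀ u, ‖g u‖ ≤ M := fun u =>
    le_of_tendsto (hg u).norm (Eventually.of_forall fun n => hM n u)
  have hgs : ∀ u ∉ closedBall c r, g u = 0 := fun u hu =>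
    tendsto_nhds_unique (hg u) (by simp [hs _ u hu])
  have hL : Tendsto (fun n => ∫ u, ‖h n u - g u‖) atTop (𝓝 0) := by
    have : Tendsto (fun n => ∫ u, ‖h n u - g u‖) atTop (𝓝 (∫ _ : ℂ, (0:ℝ))) := by
      refine tendsto_integral_of_dominated_convergence
        (bound := (closedBall c r).indicator fun _ => 2 * M)
        (fun n => ((hh n).aestronglyMeasurable.sub hgm).norm) ?_ ?_ ?_
      · exact (integrable_indicator_iff measurableSet_closedBall).2
          (integrableOn_const measure_closedBall_lt_top.ne)
      · refine fun n => Eventually.of_forall fun u => ?_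
        by_cases hu : u ∈ closedBall c r
        · rw [indicator_of_mem hu, norm_norm]
          linarith [norm_sub_le (h n u) (g u), hM n u, hgM u]
        · simp [indicator_of_notMem hu, hs n u hu, hgs u hu]
      · refine Eventually.of_forall fun u => ?_
        simpa using ((hg u).sub_const (g u)).norm
    simpa using this
  have hint : ∀ n, Integrable fun u => ‖h n u - g u‖ := by
    intro n
    have : IntegrableOn g (closedBall c r) :=
      Measure.integrableOn_of_bounded measure_closedBall_lt_top.ne hgm
        (Eventually.of_forall hgM)
    have hgi : Integrable g := (integrableOn_iff_integrable_of_support_subset fun u hu => by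
      by_contra h; exact hu (hgs u h)).1 this
    exact (((hh n).integrable_of_hasCompactSupport (hc n)).sub hgi).norm
  have hU : UniformCauchySeqOn (fun n => cauchyTransform (h n)) atTop univ := by
    rw [Metric.uniformCauchySeqOn_iff]
    intro η hη
    have hδ : ∀ᶠ δ in 𝓝[>] (0:ℝ), 2 * M * ∫ u in ball (0 : ℂ) δ, ‖u⁻¹‖ < η / 2 := by
      have := tendsto_integral_ball_norm_inv.const_mul (2 * M)
      rw [mul_zero] at this
      exact this.eventually_lt_const (by positivity)
    obtain ⟨δ, hδ1, hδ0⟩ := (hδ.and self_mem_nhdsWithin).exists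
    have hδ0 : 0 < δ := hδ0
    obtain ⟨N, hN⟩ := eventually_atTop.1
      (hL.eventually_lt_const (show (0:ℝ) < δ * η / 4 by positivity))
    refine ⟨N, fun m hm n hn z _ => ?_⟩
    rw [dist_eq_norm, ← cauchyTransform_sub (hh m) (hc m) (hh n) (hc n)]
    have hb := norm_cauchyTransform_le (h := fun u => h m u - h n u) ((hh m).sub (hh n))
      ((hc m).sub (hc n)) hδ0 (M := 2 * M)
      (fun u => by linarith [norm_sub_le (h m u) (h n u), hM m u, hM n u]) z
    have h1 : ∫ u, ‖h m u - h n u‖ < δ * η / 2 := by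
      have h2 : ∫ u, ‖h m u - h n u‖ ≤ (∫ u, ‖h m u - g u‖) + ∫ u, ‖h n u - g u‖ := by
        rw [← integral_add (hint m) (hint n)]
        refine integral_mono (((hh m).sub (hh n)).norm.integrable_of_hasCompactSupport
          ((hc m).sub (hc n)).norm) ((hint m).add (hint n)) fun u => ?_
        have := norm_sub_le (h m u - g u) (h n u - g u)
        simpa using this
      linarith [hN m hm, hN n hn]
    have h3 : δ⁻¹ * ∫ u, ‖h m u - h n u‖ < η / 2 := by
      rw [inv_mul_lt_iff₀ hδ0]; linarith
    linarith
  have hpt : ∀ z, ∃ l, Tendsto (fun n => cauchyTransform (h n) z) atTop (𝓝 l) := fun z =>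
    cauchySeq_tendsto_of_complete (hU.cauchy_map (mem_univ z))
  choose s hs using hpt
  exact ⟨s, tendstoUniformlyOn_univ.1 (hU.tendstoUniformlyOn_of_tendsto fun z _ => hs z)⟩

theorem ContDiffBump.contDiff_smul {c : ℂ} (χ : ContDiffBump c) {φ : ℂ → ℂ}
    (hφ : ∀ z ∈ closedBall c χ.rOut, ContDiffAt ℝ 1 φ z) : ContDiff ℝ 1 fun z => χ z • φ z := by
  rw [contDiff_iff_contDiffAt]
  intro z
  by_cases hz : z ∈ closedBall c χ.rOut
  · exact χ.contDiff.contDiffAt.smul (hφ z hz)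
  · have : (fun z => χ z • φ z) =ᶠ[𝓝 z] fun _ => 0 := by
      filter_upwards [isClosed_closedBall.isOpen_compl.mem_nhds hz] with u hu
      rw [χ.zero_of_le_dist (le_of_lt (by simpa using hu)), zero_smul]
    exact contDiffAt_const.congr_of_eventuallyEq this

theorem ContDiffBump.smul_eq_zero_of_notMem {c : ℂ} (χ : ContDiffBump c) (φ : ℂ → ℂ) :
    ∀ z ∉ closedBall c χ.rOut, χ z • φ z = 0 := fun z hz => by
  rw [χ.zero_of_le_dist, zero_smul]
  simpa using le_of_lt (not_le.1 hz)

theorem ContDiffBump.norm_smul_le {c : ℂ} (χ : ContDiffBump c) {φ : ℂ → ℂ} {M : ℝ} (hM : 0 ≤ M)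
    (hφ : ∀ z ∈ closedBall c χ.rOut, ‖φ z‖ ≤ M) (z : ℂ) : ‖χ z • φ z‖ ≤ M := by
  by_cases hz : z ∈ closedBall c χ.rOut
  · rw [norm_smul, Real.norm_of_nonneg χ.nonneg]
    exact (mul_le_of_le_one_left (norm_nonneg _) χ.le_one).trans (hφ z hz)
  · rwa [χ.smul_eq_zero_of_notMem φ z hz, norm_zero]

theorem dbar_mul {f g : ℂ → ℂ} {z : ℂ} (hf : DifferentiableAt ℝ f z)
    (hg : DifferentiableAt ℝ g z) :
    dbar (fun u => f u * g u) z = dbar f z * g z + f z * dbar g z := by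
  simp only [dbar, fderiv_fun_mul hf hg]
  simp
  ring

theorem dbar_sub {f g : ℂ → ℂ} {z : ℂ} (hf : DifferentiableAt ℝ f z)
    (hg : DifferentiableAt ℝ g z) :
    dbar (fun u => f u - g u) z = dbar f z - dbar g z := by
  simp only [dbar, fderiv_fun_sub hf hg]
  simp
  ring

theorem dbar_exp_neg {f : ℂ → ℂ} {z : ℂ} (hf : DifferentiableAt ℝ f z) :
    dbar (fun u => Complex.exp (-f u)) z = -(Complex.exp (-f z) * dbar f z) := by
  simp only [dbar, (hf.hasFDerivAt.fun_neg.cexp).fderiv]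
  simp
  ring

theorem DifferentiableAt.complex_of_dbar_eq_zero {f : ℂ → ℂ} {z : ℂ}
    (hf : DifferentiableAt ℝ f z) (h : dbar f z = 0) : DifferentiableAt ℂ f z := by
  rw [differentiableAt_complex_iff_differentiableAt_real]
  refine ⟨hf, ?_⟩
  simp only [dbar] at h
  rw [smul_eq_mul]
  linear_combination -Complex.I * h + fderiv ℝ f z Complex.I * Complex.I_mul_I

/-- The regularised quotient `G / W`. -/
noncomputable def regQuot (W G : ℂ → ℂ) (ε : ℝ) (z : ℂ) : ℂ :=
  (‖W z‖ ^ 2 + ε ^ 2)⁻¹ • (G z * starRingEnd ℂ (W z))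

theorem ContDiffAt.regQuot {W G : ℂ → ℂ} {ε : ℝ} (hε : 0 < ε) {z : ℂ} (hW : ContDiffAt ℝ 1 W z)
    (hG : ContDiffAt ℝ 1 G z) : ContDiffAt ℝ 1 (regQuot W G ε) z := by
  refine ((hW.norm_sq ℝ).add contDiffAt_const).inv (by positivity) |>.smul (hG.mul ?_)
  exact Complex.conjCLE.contDiff.contDiffAt.comp z hW

theorem norm_regQuot_le {W G : ℂ → ℂ} {ε M : ℝ} (hε : 0 < ε) (hM : 0 ≤ M) {z : ℂ}
    (h : ‖G z‖ ≤ M * ‖W z‖) : ‖regQuot W G ε z‖ ≤ M := by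
  have hp : 0 < ‖W z‖ ^ 2 + ε ^ 2 := by positivity
  rw [regQuot, norm_smul, norm_inv, Real.norm_of_nonneg hp.le, norm_mul, RCLike.norm_conj,
    inv_mul_le_iff₀ hp]
  nlinarith [mul_le_mul_of_nonneg_right h (norm_nonneg (W z)), mul_nonneg hM (sq_nonneg ε)]

theorem norm_sub_regQuot_mul_le {W G : ℂ → ℂ} {ε M : ℝ} (hε : 0 < ε) (hM : 0 ≤ M) {z : ℂ}
    (h : ‖G z‖ ≤ M * ‖W z‖) : ‖G z - regQuot W G ε z * W z‖ ≤ M * ε := by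
  have hp : 0 < ‖W z‖ ^ 2 + ε ^ 2 := by positivity
  have : G z - regQuot W G ε z * W z = ((‖W z‖ ^ 2 + ε ^ 2)⁻¹ * ε ^ 2) • G z := by
    have h1 : starRingEnd ℂ (W z) * W z = (‖W z‖ ^ 2 : ℝ) := by
      rw [Complex.conj_mul']; simp
    have h2 : ((‖W z‖ ^ 2 + ε ^ 2 : ℝ) : ℂ) ≠ 0 := by exact_mod_cast hp.ne'
    simp only [regQuot, Complex.real_smul]
    push_cast at h1 h2 ⊢
    field_simp
    linear_combination -G z * h1
  rw [this, norm_smul, Real.norm_of_nonneg (by positivity), mul_assoc, inv_mul_le_iff₀ hp]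
  have h3 : ‖W z‖ * ε ≤ ‖W z‖ ^ 2 + ε ^ 2 := by nlinarith [sq_nonneg (‖W z‖ - ε)]
  calc ε ^ 2 * ‖G z‖ ≤ ε ^ 2 * (M * ‖W z‖) := by gcongr
    _ = M * ε * (‖W z‖ * ε) := by ring
    _ ≤ M * ε * (‖W z‖ ^ 2 + ε ^ 2) := by gcongr
    _ = _ := by ring

theorem tendsto_regQuot {W G : ℂ → ℂ} {M : ℝ} {z : ℂ} (h : ‖G z‖ ≤ M * ‖W z‖) :
    Tendsto (fun n : ℕ => regQuot W G (1 / ((n : ℝ) + 1)) z) atTop (𝓝 (regQuot W G 0 z)) := by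
  by_cases hW : W z = 0
  · have : G z = 0 := by simpa [hW] using h
    simp [regQuot, this]
  · have h1 := tendsto_one_div_add_atTop_nhds_zero_nat (𝕜 := ℝ)
    refine (((h1.pow 2).const_add (‖W z‖ ^ 2)).inv₀ ?_).smul_const _
    have := norm_pos_iff.2 hW
    positivity

/-- A function satisfying a Carleman inequality for the Cauchy–Riemann operator is, up to a
nonvanishing factor, holomorphic. -/
theorem exists_holomorphic_eq_exp_neg_mul {W G : ℂ → ℂ} {M r : ℝ} {c : ℂ} (hr : 0 < r) (hM : 0 ≤ M)
    (hW : ∀ z ∈ closedBall c (4 * r), ContDiffAt ℝ 1 W z)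
    (hG : ∀ z ∈ closedBall c (4 * r), ContDiffAt ℝ 1 G z)
    (hWG : ∀ z ∈ closedBall c (4 * r), dbar W z = G z)
    (hGW : ∀ z ∈ closedBall c (4 * r), ‖G z‖ ≤ M * ‖W z‖) :
    ∃ s : ℂ → ℂ, DifferentiableOn ℂ (fun z => Complex.exp (-s z) * W z) (ball c r) := by
  let χ : ContDiffBump c := ⟨2 * r, 4 * r, by positivity, by linarith⟩
  let χ' : ContDiffBump c := ⟨r, 2 * r, by positivity, by linarith⟩
  let ε : ℕ → ℝ := fun n => 1 / ((n : ℝ) + 1)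
  have hε : ∀ n, 0 < ε n := fun n => by positivity
  have hε0 : Tendsto ε atTop (𝓝 0) := tendsto_one_div_add_atTop_nhds_zero_nat
  let g : ℕ → ℂ → ℂ := fun n z => χ z • regQuot W G (ε n) z
  have hg : ∀ n, ContDiff ℝ 1 (g n) := fun n =>
    χ.contDiff_smul fun z hz => (hW z hz).regQuot (hε n) (hG z hz)
  have hgM : ∀ n u, ‖g n u‖ ≤ M := fun n u =>
    χ.norm_smul_le hM (fun z hz => norm_regQuot_le (hε n) hM (hGW z hz)) u
  have hgs : ∀ n, ∀ u ∉ closedBall c (4 * r), g n u = 0 := fun n u hu =>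
    χ.smul_eq_zero_of_notMem _ u hu
  have hgc : ∀ n, HasCompactSupport (g n) := fun n =>
    HasCompactSupport.intro (isCompact_closedBall c _) (hgs n)
  obtain ⟨s, hs⟩ := exists_tendstoUniformly_cauchyTransform (g := fun z => χ z • regQuot W G 0 z)
    (fun n => (hg n).continuous) hgM hgs (fun u => by
      by_cases hu : u ∈ closedBall c (4 * r)
      · exact (tendsto_regQuot (hGW u hu)).const_smul _
      · have h1 : χ u • regQuot W G 0 u = 0 := χ.smul_eq_zero_of_notMem _ u hu
        simp only [hgs _ u hu, h1]
        exact tendsto_const_nhds)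
  refine ⟨s, ?_⟩
  let σ : ℕ → ℂ → ℂ := fun n => cauchyTransform (g n)
  have hσ : ∀ n, ContDiff ℝ 1 (σ n) := fun n => contDiff_cauchyTransform (hg n) (hgc n)
  obtain ⟨S, hS⟩ : ∃ S, ∀ n z, ‖σ n z‖ ≤ S :=
    ⟨_, fun n z => norm_cauchyTransform_le_of_support (hg n).continuous (hgM n) (hgs n) z⟩
  have hE : ∀ n z, ‖Complex.exp (-σ n z)‖ ≤ Real.exp S := fun n z => by
    rw [Complex.norm_exp, Real.exp_le_exp]
    exact ((Complex.re_le_norm _).trans_eq (norm_neg _)).trans (hS n z)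
  have hexp : ∀ n, ContDiff ℝ 1 fun z => Complex.exp (-σ n z) := fun n => (hσ n).neg.cexp
  have hsub : closedBall c (2 * r) ⊆ closedBall c (4 * r) :=
    closedBall_subset_closedBall (by linarith)
  let k : ℕ → ℂ → ℂ := fun n z =>
    χ' z • (Complex.exp (-σ n z) * (G z - regQuot W G (ε n) z * W z))
  have hk : ∀ n, ContDiff ℝ 1 (k n) := fun n => χ'.contDiff_smul fun z hz =>
    (hexp n).contDiffAt.mul ((hG z (hsub hz)).sub
      (((hW z (hsub hz)).regQuot (hε n) (hG z (hsub hz))).mul (hW z (hsub hz))))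
  have hks : ∀ n, ∀ u ∉ closedBall c (2 * r), k n u = 0 := fun n u hu =>
    χ'.smul_eq_zero_of_notMem
      (fun z => Complex.exp (-σ n z) * (G z - regQuot W G (ε n) z * W z)) u hu
  have hkc : ∀ n, HasCompactSupport (k n) := fun n =>
    HasCompactSupport.intro (isCompact_closedBall c _) (hks n)
  have hkM : ∀ n u, ‖k n u‖ ≤ Real.exp S * (M * ε n) := fun n u =>
    χ'.norm_smul_le (mul_nonneg (Real.exp_pos _).le (mul_nonneg hM (hε n).le)) (fun z hz => by
      rw [norm_mul]
      exact mul_le_mul (hE n z) (norm_sub_regQuot_mul_le (hε n) hM (hGW z (hsub hz)))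
        (norm_nonneg _) (Real.exp_pos _).le) u
  have hκ : TendstoUniformly (fun n => cauchyTransform (k n)) (fun _ => 0) atTop := by
    rw [Metric.tendstoUniformly_iff]
    intro η hη
    have h1 := ((hε0.const_mul M).const_mul (Real.exp S)).mul_const
      ((∫ u in ball (0 : ℂ) 1, ‖u⁻¹‖) + volume.real (closedBall c (2 * r)))
    simp only [mul_zero, zero_mul] at h1
    filter_upwards [h1.eventually_lt_const hη] with n hn z
    rw [dist_zero_left]
    exact (norm_cauchyTransform_le_of_support (hk n).continuous (hkM n) (hks n) z).trans_lt hn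
  have hdiff : ∀ n, DifferentiableOn ℂ
      (fun z => Complex.exp (-σ n z) * W z - cauchyTransform (k n) z) (ball c r) := by
    intro n z hz
    have hz1 : z ∈ closedBall c r := ball_subset_closedBall hz
    have hz4 : z ∈ closedBall c (4 * r) := closedBall_subset_closedBall (by linarith) hz1
    have d1 := ((hexp n).differentiable one_ne_zero) z
    have d2 := (hW z hz4).differentiableAt one_ne_zero
    have d3 := (contDiff_cauchyTransform (hk n) (hkc n)).differentiable one_ne_zero z
    refine ((d1.mul d2).sub d3).complex_of_dbar_eq_zero ?_ |>.differentiableWithinAt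
    have e1 : χ z = 1 := χ.one_of_mem_closedBall (closedBall_subset_closedBall (by linarith) hz1)
    have e2 : χ' z = 1 := χ'.one_of_mem_closedBall hz1
    erw [dbar_sub (d1.mul d2) d3, dbar_mul d1 d2, dbar_cauchyTransform (hk n) (hkc n),
      dbar_exp_neg ((hσ n).differentiable one_ne_zero z), dbar_cauchyTransform (hg n) (hgc n),
      hWG z hz4]
    simp only [k, g, e1, e2, one_smul]
    ring
  refine TendstoLocallyUniformlyOn.differentiableOn (φ := atTop)
    (F := fun n z => Complex.exp (-σ n z) * W z - cauchyTransform (k n) z)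
    ?_ (Eventually.of_forall hdiff) isOpen_ball
  refine TendstoUniformlyOn.tendstoLocallyUniformlyOn ?_
  obtain ⟨B, hB⟩ : ∃ B, ∀ z ∈ closedBall c (4 * r), ‖W z‖ ≤ B :=
    (isCompact_closedBall c (4 * r)).exists_bound_of_continuousOn fun z hz =>
      (hW z hz).continuousAt.continuousWithinAt
  have hsS : ∀ z, ‖s z‖ ≤ S := fun z =>
    le_of_tendsto (hs.tendsto_at z).norm (Eventually.of_forall fun n => hS n z)
  have huc : UniformContinuousOn Complex.exp (closedBall 0 S) :=
    (isCompact_closedBall 0 S).uniformContinuousOn_of_continuous Complex.continuous_exp.continuousOn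
  rw [Metric.tendstoUniformlyOn_iff]
  intro η hη
  rw [Metric.uniformContinuousOn_iff] at huc
  obtain ⟨δ, hδ, huc⟩ := huc (η / 2 / (|B| + 1)) (by positivity)
  filter_upwards [Metric.tendstoUniformly_iff.1 hs δ hδ,
    Metric.tendstoUniformly_iff.1 hκ (η / 2) (by positivity)] with n h1 h2 z hz
  have hz4 : z ∈ closedBall c (4 * r) :=
    closedBall_subset_closedBall (by linarith) (ball_subset_closedBall hz)
  have h3 : ‖Complex.exp (-s z) - Complex.exp (-σ n z)‖ < η / 2 / (|B| + 1) := by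
    rw [← dist_eq_norm]
    refine huc _ (by simpa using hsS z) _ (by simpa using hS n z) ?_
    rw [dist_neg_neg]
    exact h1 z
  have h4 : ‖cauchyTransform (k n) z‖ < η / 2 := by simpa using h2 z
  rw [dist_eq_norm, show Complex.exp (-s z) * W z - (Complex.exp (-σ n z) * W z -
    cauchyTransform (k n) z) = (Complex.exp (-s z) - Complex.exp (-σ n z)) * W z +
      cauchyTransform (k n) z by ring]
  refine (norm_add_le _ _).trans_lt ?_
  have h5 : ‖(Complex.exp (-s z) - Complex.exp (-σ n z)) * W z‖ ≤ η / 2 := by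
    rw [norm_mul]
    calc _ ≤ η / 2 / (|B| + 1) * (|B| + 1) := by
          gcongr
          linarith [hB z hz4, le_abs_self B]
      _ = η / 2 := by field_simp
  linarith

theorem eventually_eq_zero_or_eventually_ne_zero_of_norm_dbar_le {W G : ℂ → ℂ} {M : ℝ} {c : ℂ}
    (hM : 0 ≤ M) (hW : ContDiffAt ℝ 1 W c) (hG : ContDiffAt ℝ 1 G c)
    (hWG : ∀ᶠ z in 𝓝 c, dbar W z = G z) (hGW : ∀ᶠ z in 𝓝 c, ‖G z‖ ≤ M * ‖W z‖) :
    (∀ᶠ z in 𝓝 c, W z = 0) ∨ ∀ᶠ z in 𝓝[≠] c, W z ≠ 0 := by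
  obtain ⟨R, hR, h⟩ := Metric.nhds_basis_closedBall.eventually_iff.1
    ((hW.eventually (by simp)).and ((hG.eventually (by simp)).and (hWG.and hGW)))
  obtain ⟨s, hs⟩ := exists_holomorphic_eq_exp_neg_mul (W := W) (G := G) (c := c) (r := R / 4)
    (by positivity) hM (fun z hz => (h (by simpa [mul_div_cancel₀] using hz)).1)
    (fun z hz => (h (by simpa [mul_div_cancel₀] using hz)).2.1)
    (fun z hz => (h (by simpa [mul_div_cancel₀] using hz)).2.2.1)
    (fun z hz => (h (by simpa [mul_div_cancel₀] using hz)).2.2.2)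
  have ha := (hs.analyticOnNhd isOpen_ball c (mem_ball_self (by positivity)))
  simpa using ha.eventually_eq_zero_or_eventually_ne_zero

section
open scoped unitInterval ContDiff

section
variable (q : FormalMultilinearSeries ℝ (ℝ × ℝ) ℂ) (A : Type) [NormedCommRing A] [NormedAlgebra ℂ A]

/-- The extension of a power series in two real variables to a commutative Banach algebra. -/
noncomputable def FormalMultilinearSeries.extend : FormalMultilinearSeries ℂ (A × A) A := fun n =>
  ∑ s : Fin n → Bool, (q n fun i => cond (s i) (0, 1) (1, 0)) •
    (ContinuousMultilinearMap.mkPiAlgebra ℂ (Fin n) A).compContinuousLinearMap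
      fun i => cond (s i) (ContinuousLinearMap.snd ℂ A A) (ContinuousLinearMap.fst ℂ A A)

theorem FormalMultilinearSeries.extend_apply (n : ℕ) (v : A × A) :
    q.extend A n (fun _ => v) = ∑ s : Fin n → Bool,
      (q n fun i => cond (s i) (0, 1) (1, 0)) • ∏ i, cond (s i) v.2 v.1 := by
  simp only [extend, _root_.sum_apply, _root_.smul_apply,
    ContinuousMultilinearMap.compContinuousLinearMap_apply,
    ContinuousMultilinearMap.mkPiAlgebra_apply]
  refine Finset.sum_congr rfl fun s _ => ?_
  congr 1
  refine Finset.prod_congr rfl fun i _ => ?_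
  cases s i <;> rfl

theorem FormalMultilinearSeries.norm_extend_le [NormOneClass A] (n : ℕ) :
    ‖q.extend A n‖ ≤ 2 ^ n * ‖q n‖ := by
  refine (norm_sum_le_of_le (f := fun s : Fin n → Bool =>
    (q n fun i => cond (s i) (0, 1) (1, 0)) •
    (ContinuousMultilinearMap.mkPiAlgebra ℂ (Fin n) A).compContinuousLinearMap
      fun i => cond (s i) (ContinuousLinearMap.snd ℂ A A) (ContinuousLinearMap.fst ℂ A A))
    (n := fun _ => ‖q n‖) _ fun s _ => ?_).trans (by simp)
  have h1 : ‖q n fun i => cond (s i) ((0, 1) : ℝ × ℝ) (1, 0)‖ ≤ ‖q n‖ := by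
    refine ((q n).le_opNorm _).trans ?_
    refine mul_le_of_le_one_right (norm_nonneg _) (Finset.prod_le_one (fun _ _ => norm_nonneg _) ?_)
    intro i _
    cases s i <;> simp [Prod.norm_def]
  have h2 : ‖(ContinuousMultilinearMap.mkPiAlgebra ℂ (Fin n) A).compContinuousLinearMap
      fun i => cond (s i) (ContinuousLinearMap.snd ℂ A A) (ContinuousLinearMap.fst ℂ A A)‖ ≤ 1 := by
    refine (ContinuousMultilinearMap.norm_compContinuousLinearMap_le _ _).trans ?_
    rw [ContinuousMultilinearMap.norm_mkPiAlgebra, one_mul]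
    refine Finset.prod_le_one (fun _ _ => norm_nonneg _) fun i _ => ?_
    cases s i
    · exact ContinuousLinearMap.norm_fst_le ..
    · exact ContinuousLinearMap.norm_snd_le ..
  rw [norm_smul]
  exact (mul_le_of_le_one_right (norm_nonneg _) h2).trans h1

end

theorem FormalMultilinearSeries.exists_le_radius_extend
    (q : FormalMultilinearSeries ℝ (ℝ × ℝ) ℂ) (hq : 0 < q.radius) :
    ∃ ρ : NNReal, 0 < ρ ∧ ∀ (A : Type) [NormedCommRing A] [NormedAlgebra ℂ A] [NormOneClass A],
      (ρ : ENNReal) ≤ (q.extend A).radius := by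
  obtain ⟨C, r, hC, hr, h⟩ := q.le_mul_pow_of_radius_pos hq
  refine ⟨(2 * r)⁻¹.toNNReal, Real.toNNReal_pos.2 (by positivity), fun A _ _ _ => ?_⟩
  refine FormalMultilinearSeries.le_radius_of_bound _ C fun n => ?_
  rw [Real.coe_toNNReal _ (by positivity)]
  calc _ ≤ 2 ^ n * (C * r ^ n) * ((2 * r)⁻¹) ^ n := by
        gcongr
        exact (q.norm_extend_le A n).trans (by gcongr; exact h n)
    _ = C * (2 * r * (2 * r)⁻¹) ^ n := by
        rw [mul_pow, mul_pow]
        ring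
    _ = C := by rw [mul_inv_cancel₀ (by positivity), one_pow, mul_one]

theorem FormalMultilinearSeries.extend_ofReal (q : FormalMultilinearSeries ℝ (ℝ × ℝ) ℂ) (n : ℕ)
    (x y : ℝ) : q.extend ℂ n (fun _ => ((x : ℂ), (y : ℂ))) = q n fun _ => (x, y) := by
  rw [extend_apply]
  have h : (fun _ : Fin n => ((x, y) : ℝ × ℝ)) =
      fun _ => ∑ b : Bool, (cond b y x) • (cond b (0, 1) (1, 0) : ℝ × ℝ) := by
    ext <;> simp
  rw [h, ContinuousMultilinearMap.map_sum]
  refine Finset.sum_congr rfl fun s _ => ?_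
  rw [ContinuousMultilinearMap.map_smul_univ, Complex.real_smul, smul_eq_mul, mul_comm]
  congr 1
  push_cast
  refine Finset.prod_congr rfl fun i _ => ?_
  cases s i <;> rfl

/-- Evaluation of the extension to an algebra of continuous functions. -/
theorem FormalMultilinearSeries.extend_continuousMap (q : FormalMultilinearSeries ℝ (ℝ × ℝ) ℂ)
    {X : Type} [TopologicalSpace X] [CompactSpace X] [Nonempty X] {ρ : NNReal}
    (hρ : (ρ : ENNReal) ≤ (q.extend C(X, ℂ)).radius) {u v : C(X, ℂ)} (hu : ‖(u, v)‖ < ρ) (t : X) :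
    (q.extend C(X, ℂ)).sum (u, v) t = (q.extend ℂ).sum (u t, v t) := by
  have h1 : HasSum (fun n => q.extend C(X, ℂ) n fun _ => (u, v)) ((q.extend C(X, ℂ)).sum (u, v)) :=
    FormalMultilinearSeries.hasSum _ (by
      refine (Metric.eball_subset_eball hρ) ?_
      simpa [← NNReal.coe_lt_coe] using hu)
  have h2 := h1.mapL (ContinuousMap.evalCLM ℂ t)
  refine h2.tsum_eq.symm.trans ?_
  simp only [FormalMultilinearSeries.sum]
  congr 1
  ext n
  simp only [extend_apply, map_sum, map_smul, ContinuousMap.evalCLM_apply, ContinuousMap.coe_prod,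
    Finset.prod_apply]
  refine Finset.sum_congr rfl fun s _ => ?_
  congr 1
  refine Finset.prod_congr rfl fun i _ => ?_
  cases s i <;> rfl

end

section
open scoped unitInterval ContDiff

/-- The map sending `c` to `t ↦ ∫ τ in t..1, c τ`. -/
noncomputable def tailIntegral : C(I, ℂ) →L[ℂ] C(I, ℂ) :=
  LinearMap.mkContinuous
    { toFun := fun c => ⟨fun t => ∫ τ in (t : ℝ)..1, c (projIcc 0 1 zero_le_one τ), by
        have hc : Continuous fun τ : ℝ => c (projIcc 0 1 zero_le_one τ) :=
          c.continuous.comp continuous_projIcc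
        have h : Continuous fun t : ℝ => ∫ τ in (t : ℝ)..1, c (projIcc 0 1 zero_le_one τ) := by
          simp only [intervalIntegral.integral_symm 1]
          exact (intervalIntegral.continuous_primitive (fun _ _ => hc.intervalIntegrable _ _) 1).neg
        exact h.comp continuous_subtype_val⟩
      map_add' := fun c d => by
        ext t
        exact intervalIntegral.integral_add
          ((c.continuous.comp continuous_projIcc).intervalIntegrable _ _)
          ((d.continuous.comp continuous_projIcc).intervalIntegrable _ _)
      map_smul' := fun a c => by
        ext t
        exact intervalIntegral.integral_smul a fun τ => c (projIcc 0 1 zero_le_one τ) }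
    1 fun c => by
      rw [one_mul, ContinuousMap.norm_le _ (norm_nonneg _)]
      intro t
      refine (intervalIntegral.norm_integral_le_of_norm_le_const
        (fun τ _ => c.norm_coe_le_norm _)).trans ?_
      refine mul_le_of_le_one_right (norm_nonneg _) ?_
      rw [abs_of_nonneg (by linarith [t.2.2])]
      linarith [t.2.1]

theorem tailIntegral_apply (c : C(I, ℂ)) (t : I) :
    tailIntegral c t = ∫ τ in (t : ℝ)..1, c (projIcc 0 1 zero_le_one τ) := rfl

/-- The inclusion of the unit interval in the complex numbers. -/
noncomputable def unitInterval.coeC : C(I, ℂ) := ⟨fun τ => ((τ : ℝ) : ℂ), by fun_prop⟩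

theorem unitInterval.norm_coeC_le : ‖unitInterval.coeC‖ ≤ 1 := by
  rw [ContinuousMap.norm_le _ zero_le_one]
  intro τ
  simpa [coeC, abs_of_nonneg τ.2.1] using τ.2.2

/-- Solutions of the integral form of `y' = -Λ(x, y)` depend smoothly on the initial point. -/
theorem exists_contDiffAt_integral_solution (q : FormalMultilinearSeries ℝ (ℝ × ℝ) ℂ)
    (hq : 0 < q.radius) :
    ∃ φ : ℂ × ℂ → C(I, ℂ), ContDiffAt ℂ 2 φ 0 ∧ φ 0 = 0 ∧ ∃ r > 0,
      ContinuousOn (q.extend ℂ).sum (ball 0 r) ∧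
      ∀ z : ℂ × ℂ, ‖z‖ < r → ∀ u : C(I, ℂ), ‖u‖ < r →
        ((∀ t : I, u t = z.2 + z.1 * ∫ τ in (t : ℝ)..1, (q.extend ℂ).sum
          (z.1 * (projIcc 0 1 zero_le_one τ : I), u (projIcc 0 1 zero_le_one τ))) ↔ φ z = u) := by
  obtain ⟨ρ, hρ, hrad⟩ := q.exists_le_radius_extend hq
  have hA : ContDiffAt ℂ 2 (q.extend C(I, ℂ)).sum 0 :=
    ((FormalMultilinearSeries.hasFPowerSeriesOnBall _
      ((ENNReal.coe_pos.2 hρ).trans_le (hrad _))).analyticAt.contDiffAt (n := ω)).of_le le_top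
  have h0 : ∀ c : C(I, ℂ), (0 : ℂ) • c = 0 := fun c => by ext; simp
  let Φ : (ℂ × ℂ) × C(I, ℂ) → C(I, ℂ) := fun v => v.2 - v.1.2 • (1 : C(I, ℂ)) -
    v.1.1 • tailIntegral ((q.extend C(I, ℂ)).sum (v.1.1 • unitInterval.coeC, v.2))
  have hΦ : ContDiffAt ℂ 2 Φ 0 := by
    have h1 : ContDiffAt ℂ 2 (fun v : (ℂ × ℂ) × C(I, ℂ) =>
        (q.extend C(I, ℂ)).sum (v.1.1 • unitInterval.coeC, v.2)) 0 := by
      refine ContDiffAt.comp (g := (q.extend C(I, ℂ)).sum) (0 : (ℂ × ℂ) × C(I, ℂ)) ?_ (by fun_prop)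
      rw [show (((0 : (ℂ × ℂ) × C(I, ℂ)).1.1 • unitInterval.coeC, (0 : (ℂ × ℂ) × C(I, ℂ)).2) :
        C(I, ℂ) × C(I, ℂ)) = 0 from Prod.ext (h0 _) rfl]
      exact hA
    have h2 := tailIntegral.contDiff.contDiffAt.comp (0 : (ℂ × ℂ) × C(I, ℂ)) h1
    have h3 : ContDiffAt ℂ 2 (fun v : (ℂ × ℂ) × C(I, ℂ) => v.1.1) 0 := by fun_prop
    have h4 : ContDiffAt ℂ 2 (fun v : (ℂ × ℂ) × C(I, ℂ) => v.2 - v.1.2 • (1 : C(I, ℂ))) 0 := by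
      fun_prop
    exact h4.sub (h3.smul h2)
  have hΦ0 : Φ 0 = 0 := by simp [Φ, h0]
  have hinv : (fderiv ℂ Φ 0 ∘L .inr ℂ (ℂ × ℂ) C(I, ℂ)).IsInvertible := by
    have h1 : HasFDerivAt (fun u : C(I, ℂ) => Φ (ContinuousLinearMap.inr ℂ (ℂ × ℂ) C(I, ℂ) u))
        (fderiv ℂ Φ 0 ∘L .inr ℂ (ℂ × ℂ) C(I, ℂ)) 0 := by
      refine HasFDerivAt.comp (g := Φ) (0 : C(I, ℂ)) ?_
        (ContinuousLinearMap.inr ℂ (ℂ × ℂ) C(I, ℂ)).hasFDerivAt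
      rw [map_zero]
      exact (hΦ.differentiableAt two_ne_zero).hasFDerivAt
    have h2 : (fun u : C(I, ℂ) => Φ (ContinuousLinearMap.inr ℂ (ℂ × ℂ) C(I, ℂ) u)) = id := by
      ext u
      simp [Φ]
    rw [h2] at h1
    rw [h1.unique (hasFDerivAt_id _)]
    exact ⟨ContinuousLinearEquiv.refl ℂ _, rfl⟩
  have hev := hΦ.eventually_apply_eq_iff_implicitFunction two_ne_zero hinv
  rw [hΦ0] at hev
  obtain ⟨r, hr, hball⟩ := Metric.eventually_nhds_iff.1 hev
  refine ⟨hΦ.implicitFunction two_ne_zero hinv, hΦ.contDiffAt_implicitFunction two_ne_zero hinv,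
    hΦ.implicitFunction_apply_self two_ne_zero hinv, min r ρ, lt_min hr hρ, ?_, ?_⟩
  · refine (FormalMultilinearSeries.hasFPowerSeriesOnBall _
      ((ENNReal.coe_pos.2 hρ).trans_le (hrad ℂ))).continuousOn.mono ?_
    refine subset_trans ?_ (eball_subset_eball (hrad ℂ))
    rw [Metric.eball_coe]
    exact ball_subset_ball (min_le_right _ _)
  · intro z hz u hu
    have h1 : dist (z, u) 0 < r := by
      simp only [dist_zero_right, Prod.norm_def (z, u)]
      exact max_lt (hz.trans_le (min_le_left _ _)) (hu.trans_le (min_le_left _ _))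
    have h3 : ‖(z.1 • unitInterval.coeC, u)‖ < ρ := by
      rw [Prod.norm_def]
      refine max_lt ?_ (hu.trans_le (min_le_right _ _))
      rw [norm_smul]
      exact ((mul_le_of_le_one_right (norm_nonneg _) unitInterval.norm_coeC_le).trans
        (norm_fst_le z)).trans_lt (hz.trans_le (min_le_right _ _))
    rw [← hball h1, ContinuousMap.ext_iff]
    refine forall_congr' fun t => ?_
    have h4 : Φ (z, u) t = u t - z.2 - z.1 * ∫ τ in (t : ℝ)..1, (q.extend ℂ).sum
        (z.1 * (projIcc 0 1 zero_le_one τ : I), u (projIcc 0 1 zero_le_one τ)) := by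
      simp only [Φ, ContinuousMap.sub_apply, ContinuousMap.smul_apply, tailIntegral_apply,
        q.extend_continuousMap (hrad _) h3, smul_eq_mul, ContinuousMap.one_apply, mul_one]
      rfl
    rw [h4, ContinuousMap.zero_apply, sub_sub, sub_eq_zero]

end

theorem exists_first_integral (q : FormalMultilinearSeries ℝ (ℝ × ℝ) ℂ) (hq : 0 < q.radius) :
    ∃ Z : ℂ × ℂ → ℂ, ContDiffAt ℂ 2 Z 0 ∧ fderiv ℂ Z 0 (0, 1) = 1 ∧
      ∀ᶠ z in 𝓝 0, fderiv ℂ Z z (1, 0) = (q.extend ℂ).sum z * fderiv ℂ Z z (0, 1) := by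
  obtain ⟨φ, hφ, hφ0, r, hr, hΛ, hsol⟩ := exists_contDiffAt_integral_solution q hq
  set Λ := (q.extend ℂ).sum
  obtain ⟨δ, hδ, hδ'⟩ : ∃ δ > 0, ∀ z, ‖z‖ < δ → ‖φ z‖ < r ∧ ContDiffAt ℂ 2 φ z ∧ ‖z‖ < r := by
    have h1 : ∀ᶠ z in 𝓝 0, ‖φ z‖ < r := by
      have := hφ.continuousAt.norm.tendsto
      rw [hφ0, norm_zero] at this
      exact this.eventually_lt_const hr
    have h2 : ∀ᶠ z : ℂ × ℂ in 𝓝 0, ‖z‖ < r :=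
      continuous_norm.continuousAt.eventually_lt_const (by simpa using hr)
    obtain ⟨δ, hδ, h⟩ := Metric.eventually_nhds_iff.1 (h1.and ((hφ.eventually (by simp)).and h2))
    exact ⟨δ, hδ, fun z hz => h (by simpa using hz)⟩
  obtain ⟨η, hη, hη'⟩ : ∃ η > 0, ∀ z, ‖z‖ < η → ‖φ z‖ < δ ∧ ‖z‖ < δ := by
    have h1 : ∀ᶠ z in 𝓝 0, ‖φ z‖ < δ := by
      have := hφ.continuousAt.norm.tendsto
      rw [hφ0, norm_zero] at this
      exact this.eventually_lt_const hδ
    have h2 : ∀ᶠ z : ℂ × ℂ in 𝓝 0, ‖z‖ < δ :=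
      continuous_norm.continuousAt.eventually_lt_const (by simpa using hδ)
    obtain ⟨η, hη, h⟩ := Metric.eventually_nhds_iff.1 (h1.and h2)
    exact ⟨η, hη, fun z hz => h (by simpa using hz)⟩
  have hZ : ∀ z, ‖z‖ < δ → ContDiffAt ℂ 2 (fun z => φ z 0) z := fun z hz =>
    ContDiffAt.comp z (g := ContinuousMap.evalCLM ℂ (0 : unitInterval))
      (ContinuousLinearMap.contDiff _).contDiffAt (hδ' z hz).2.1
  have heq : ∀ z, ‖z‖ < δ → ∀ t : unitInterval, φ z t = z.2 + z.1 * ∫ τ in (t : ℝ)..1,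
      Λ (z.1 * (projIcc 0 1 zero_le_one τ : unitInterval), φ z (projIcc 0 1 zero_le_one τ)) :=
    fun z hz => (hsol z (hδ' z hz).2.2 (φ z) (hδ' z hz).1).2 rfl
  have hmul : ∀ z, ‖z‖ < η → z.1 * fderiv ℂ (fun z => φ z 0) z (1, 0) =
      z.1 * (Λ z * fderiv ℂ (fun z => φ z 0) z (0, 1)) := by
    intro z hz
    obtain ⟨hz1, hz2⟩ := hη' z hz
    set u := φ z
    set c : ℝ → ℂ := fun τ =>
      Λ (z.1 * (projIcc 0 1 zero_le_one τ : unitInterval), u (projIcc 0 1 zero_le_one τ))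
    have hsmall : ∀ (s : unitInterval) (w : ℂ), ‖w‖ < δ → ‖((s : ℝ) * z.1, w)‖ < δ := by
      intro s w hw
      rw [Prod.norm_def]
      refine max_lt ?_ hw
      rw [norm_mul, Complex.norm_real, Real.norm_of_nonneg s.2.1]
      exact ((mul_le_of_le_one_left (norm_nonneg _) s.2.2).trans (norm_fst_le z)).trans_lt hz2
    have hc : Continuous c := by
      refine hΛ.comp_continuous (by fun_prop) fun τ => ?_
      rw [mem_ball_zero_iff, mul_comm]
      exact (hδ' _ (hsmall _ _ ((u.norm_coe_le_norm _).trans_lt hz1))).2.2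
    have hu : ∀ t : unitInterval, u t = z.2 + z.1 * ∫ τ in (t : ℝ)..1, c τ := heq z hz2
    have hconst : ∀ s : unitInterval, φ ((s : ℝ) * z.1, u s) 0 = u 0 := by
      intro s
      let v : C(unitInterval, ℂ) := u.comp ⟨fun t => s * t, by fun_prop⟩
      have hv : ∀ t, v t = u (s * t) := fun t => rfl
      have hvr : ‖v‖ < r := by
        refine lt_of_le_of_lt ?_ (hδ' z hz2).1
        rw [ContinuousMap.norm_le _ (norm_nonneg _)]
        exact fun t => u.norm_coe_le_norm _
      have := (hsol ((s : ℝ) * z.1, u s)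
        (hδ' _ (hsmall s _ ((u.norm_coe_le_norm _).trans_lt hz1))).2.2 v hvr).1 ?_
      · rw [this, hv, mul_zero]
      · intro t
        have h1 : ∫ τ in (t : ℝ)..1, Λ ((s : ℝ) * z.1 * (projIcc 0 1 zero_le_one τ : unitInterval),
            v (projIcc 0 1 zero_le_one τ)) = ∫ τ in (t : ℝ)..1, c (s * τ) := by
          refine intervalIntegral.integral_congr fun τ hτ => ?_
          rw [uIcc_of_le t.2.2] at hτ
          have hτ' : τ ∈ Icc (0 : ℝ) 1 := ⟨t.2.1.trans hτ.1, hτ.2⟩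
          have hsτ : (s : ℝ) * τ ∈ Icc (0 : ℝ) 1 :=
            ⟨mul_nonneg s.2.1 hτ'.1, mul_le_one₀ s.2.2 hτ'.1 hτ'.2⟩
          simp only [c, projIcc_of_mem _ hτ', projIcc_of_mem _ hsτ, hv]
          congr 2
          push_cast
          ring
        have h2 : (s : ℂ) * ∫ τ in (t : ℝ)..1, c (s * τ) = ∫ τ in (s * t : ℝ)..s, c τ := by
          have := intervalIntegral.smul_integral_comp_mul_left c (s : ℝ) (a := t) (b := 1)
          rwa [mul_one, Complex.real_smul] at this
        have h3 : ∫ τ in (s * t : ℝ)..1, c τ =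
            (∫ τ in (s * t : ℝ)..s, c τ) + ∫ τ in (s : ℝ)..1, c τ :=
          (intervalIntegral.integral_add_adjacent_intervals (hc.intervalIntegrable _ _)
            (hc.intervalIntegrable _ _)).symm
        simp only [h1]
        rw [hv, hu, hu, Set.Icc.coe_mul, h3, ← h2]
        ring
    have hu1 : u 1 = z.2 := by simp [hu]
    let γ : ℝ → ℂ × ℂ := fun s => (s * z.1, z.2 + z.1 * ∫ τ in s..1, c τ)
    have hγ1 : γ 1 = z := by simp [γ]
    have hγ : HasDerivAt γ (z.1, z.1 * -c 1) 1 := by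
      refine HasDerivAt.prodMk ?_ ?_
      · simpa using (Complex.ofRealCLM.hasDerivAt (x := (1 : ℝ))).mul_const z.1
      · exact ((intervalIntegral.integral_hasDerivAt_left (hc.intervalIntegrable _ _)
          (hc.stronglyMeasurableAtFilter _ _) hc.continuousAt).const_mul z.1).const_add z.2
    have hd : HasFDerivAt (fun z => φ z 0) (fderiv ℂ (fun z => φ z 0) z) (γ 1) := by
      rw [hγ1]
      exact ((hZ z hz2).differentiableAt two_ne_zero).hasFDerivAt
    have hcomp := (hd.restrictScalars ℝ).comp_hasDerivAt (1 : ℝ) hγ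
    have hcw := hcomp.hasDerivWithinAt (s := Icc 0 1)
    have h0 : HasDerivWithinAt ((fun z => φ z 0) ∘ γ) 0 (Icc 0 1) 1 := by
      refine (hasDerivWithinAt_const (1 : ℝ) (Icc (0 : ℝ) 1) (u 0)).congr (fun s hs => ?_) ?_
      · have := hconst ⟨s, hs⟩
        rwa [hu ⟨s, hs⟩] at this
      · simp only [Function.comp_apply, hγ1]
        rfl
    have h1 := (uniqueDiffOn_Icc (zero_lt_one' ℝ) 1 (by simp)).eq_deriv _ hcw h0
    have hc1 : c 1 = Λ z := by simp [c, hu1]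
    have h2 : ((z.1, z.1 * -c 1) : ℂ × ℂ) = z.1 • (1, 0) + (z.1 * -c 1) • (0, 1) := by simp
    rw [h2, hc1, ContinuousLinearMap.coe_restrictScalars', map_add, map_smul, map_smul,
      smul_eq_mul, smul_eq_mul] at h1
    linear_combination h1
  refine ⟨fun z => φ z 0, hZ 0 (by simpa using hδ), ?_, ?_⟩
  · have h1 : HasFDerivAt (fun y : ℂ => φ (ContinuousLinearMap.inr ℂ ℂ ℂ y) 0)
        (fderiv ℂ (fun z => φ z 0) 0 ∘L .inr ℂ ℂ ℂ) 0 := by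
      refine HasFDerivAt.comp (g := fun z => φ z 0) (0 : ℂ) ?_
        (ContinuousLinearMap.inr ℂ ℂ ℂ).hasFDerivAt
      rw [map_zero]
      exact ((hZ 0 (by simpa using hδ)).differentiableAt two_ne_zero).hasFDerivAt
    have h2 : (fun y : ℂ => φ (ContinuousLinearMap.inr ℂ ℂ ℂ y) 0) =ᶠ[𝓝 0] id := by
      filter_upwards [Metric.ball_mem_nhds (0 : ℂ) hδ] with y hy
      have := heq (0, y) (by simpa [Prod.norm_def, hδ] using hy) 0
      simpa using this
    have h3 := (h1.congr_of_eventuallyEq h2.symm).unique (hasFDerivAt_id _)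
    simpa using congrArg (fun L : ℂ →L[ℂ] ℂ => L 1) h3
  · have hcont : ∀ w : ℂ × ℂ, ∀ z, ‖z‖ < δ →
        ContinuousAt (fun z => fderiv ℂ (fun z => φ z 0) z w) z := fun w z hz =>
      ((hZ z hz).continuousAt_fderiv two_ne_zero).clm_apply continuousAt_const
    filter_upwards [Metric.ball_mem_nhds (0 : ℂ × ℂ) hη] with z hz
    have hz : ‖z‖ < η := by simpa using hz
    have hzδ := (hη' z hz).2
    have hΛz : ContinuousAt Λ z :=
      hΛ.continuousAt (isOpen_ball.mem_nhds (by simpa using (hδ' z hzδ).2.2))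
    have hl : Tendsto (fun t : ℂ => z + (t, 0)) (𝓝[≠] 0) (𝓝 z) := by
      have : Continuous fun t : ℂ => z + (t, 0) := by fun_prop
      have h := (this.tendsto 0).mono_left (nhdsWithin_le_nhds (s := {0}ᶜ))
      rwa [show z + ((0 : ℂ), (0 : ℂ)) = z from add_zero z] at h
    have hne : ∀ᶠ t : ℂ in 𝓝[≠] 0, (z + (t, 0)).1 ≠ 0 := by
      by_cases h : z.1 = 0
      · filter_upwards [self_mem_nhdsWithin] with t ht
        simpa [h] using ht
      · exact hl.eventually ((continuous_fst.continuousAt).eventually_ne h)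
    refine tendsto_nhds_unique_of_eventuallyEq ((hcont (1, 0) z hzδ).tendsto.comp hl)
      ((hΛz.mul (hcont (0, 1) z hzδ)).tendsto.comp hl) ?_
    filter_upwards [hne, hl.eventually (isOpen_ball.mem_nhds (mem_ball_zero_iff.2 hz))] with t h1 h2
    exact mul_left_cancel₀ h1 (hmul _ (by simpa using h2))

/-- Complex-valued solutions `ζ` of `ζ_x = μ ζ_y` with `ζ_y ≠ 0`, for analytic `μ`. -/
theorem AnalyticAt.exists_isothermal {μ : ℝ × ℝ → ℂ} {p : ℝ × ℝ} (hμ : AnalyticAt ℝ μ p) :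
    ∃ ζ : ℝ × ℝ → ℂ, ContDiffAt ℝ 2 ζ p ∧ fderiv ℝ ζ p (0, 1) = 1 ∧
      ∀ᶠ x in 𝓝 p, fderiv ℝ ζ x (1, 0) = μ x * fderiv ℝ ζ x (0, 1) := by
  obtain ⟨q, hq⟩ := hμ
  obtain ⟨Z, hZ, hZ1, hZ2⟩ := exists_first_integral q hq.radius_pos
  let j : ℝ × ℝ →L[ℝ] ℂ × ℂ := Complex.ofRealCLM.prodMap Complex.ofRealCLM
  let e : ℝ × ℝ → ℂ × ℂ := fun x => j (x - p)
  have he : ∀ x, HasFDerivAt e j x := fun x => j.hasFDerivAt.comp x ((hasFDerivAt_id x).sub_const p)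
  have hec : ContDiff ℝ 2 e := j.contDiff.comp (contDiff_id.sub contDiff_const)
  have hep : e p = 0 := by simp [e]
  have het : Tendsto e (𝓝 p) (𝓝 0) := hep ▸ hec.continuous.tendsto p
  have hfd : ∀ x, DifferentiableAt ℂ Z (e x) → ∀ v,
      fderiv ℝ (fun x => Z (e x)) x v = fderiv ℂ Z (e x) (j v) := by
    intro x hx v
    have h := (hx.hasFDerivAt.restrictScalars ℝ).comp x (he x)
    rw [show (fun x => Z (e x)) = Z ∘ e from rfl, h.fderiv]
    rfl
  have hj1 : j (1, 0) = (1, 0) := by simp [j]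
  have hj2 : j (0, 1) = (0, 1) := by simp [j]
  refine ⟨fun x => Z (e x), ?_, ?_, ?_⟩
  · refine ContDiffAt.comp p (g := Z) ?_ hec.contDiffAt
    rw [hep]
    exact hZ.restrict_scalars ℝ
  · rw [hfd p (by rw [hep]; exact hZ.differentiableAt two_ne_zero), hj2, hep, hZ1]
  · have hdiff : ∀ᶠ z in 𝓝 0, DifferentiableAt ℂ Z z :=
      (hZ.eventually (by simp)).mono fun z hz => hz.differentiableAt two_ne_zero
    filter_upwards [het.eventually hZ2, het.eventually hdiff, hq.eventually_hasSum_sub]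
      with x h1 h2 h3
    rw [hfd x h2, hfd x h2, hj1, hj2, h1, ← h3.tsum_eq]
    congr 1
    exact tsum_congr fun n => q.extend_ofReal n (x - p).1 (x - p).2

theorem apply_sub_mul_apply_eq_dbar {W : ℂ → ℂ} {z m y : ℂ} :
    fderiv ℝ W z (m * y) - m * fderiv ℝ W z y =
      dbar W z / 2 * ((starRingEnd ℂ m - m) * starRingEnd ℂ y) := by
  have h : ∀ v : ℂ, fderiv ℝ W z v =
      v.re * fderiv ℝ W z 1 + v.im * fderiv ℝ W z Complex.I := by
    intro v
    conv_lhs => rw [show v = v.re • (1 : ℂ) + v.im • Complex.I by simp]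
    rw [map_add, map_smul, map_smul, Complex.real_smul, Complex.real_smul]
  rw [h (m * y), h y, dbar]
  generalize fderiv ℝ W z 1 = A
  generalize fderiv ℝ W z Complex.I = B
  have hc : ∀ v : ℂ, starRingEnd ℂ v = v.re - v.im * Complex.I := fun v => by
    apply Complex.ext <;> simp
  rw [hc, hc, Complex.mul_re, Complex.mul_im]
  conv_lhs => rw [show m = m.re + m.im * Complex.I by simp]
  conv_rhs => rw [show m = m.re + m.im * Complex.I by simp]
  simp only [Complex.add_re, Complex.add_im, Complex.mul_re, Complex.mul_im, Complex.ofReal_re,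
    Complex.ofReal_im, Complex.I_re, Complex.I_im]
  push_cast
  ring_nf
  simp only [Complex.I_sq, show Complex.I ^ 3 = -Complex.I by rw [pow_succ, Complex.I_sq]; ring]
  ring

/-- Unique continuation dichotomy for `w_x - μ w_y = g` with `|g| ≤ M |w|`. -/
theorem AnalyticAt.eventually_eq_zero_or_eventually_ne_zero_of_beltrami {μ w g : ℝ × ℝ → ℂ}
    {p : ℝ × ℝ} {M : ℝ} (hM : 0 ≤ M) (hμ : AnalyticAt ℝ μ p) (hμp : (μ p).im ≠ 0)
    (hw : ContDiffAt ℝ 1 w p) (hg : ContDiffAt ℝ 1 g p)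
    (hwg : ∀ᶠ x in 𝓝 p, fderiv ℝ w x (1, 0) - μ x * fderiv ℝ w x (0, 1) = g x)
    (hgw : ∀ᶠ x in 𝓝 p, ‖g x‖ ≤ M * ‖w x‖) :
    (∀ᶠ x in 𝓝 p, w x = 0) ∨ ∀ᶠ x in 𝓝[≠] p, w x ≠ 0 := by
  obtain ⟨ζ, hζ, hζp, hζe⟩ := hμ.exists_isothermal
  obtain ⟨L, hL⟩ : ∃ L : (ℝ × ℝ) ≃L[ℝ] ℂ, (L : ℝ × ℝ →L[ℝ] ℂ) = fderiv ℝ ζ p := by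
    have hinj : Function.Injective (fderiv ℝ ζ p : ℝ × ℝ →ₗ[ℝ] ℂ) := by
      rw [injective_iff_map_eq_zero]
      rintro ⟨a, b⟩ hab
      have h1 : ((a, b) : ℝ × ℝ) = a • (1, 0) + b • (0, 1) := by simp
      rw [ContinuousLinearMap.coe_coe, h1, map_add, map_smul, map_smul, hζe.self_of_nhds,
          hζp] at hab
      have ha : a = 0 := by simpa [hμp] using congrArg Complex.im hab
      subst ha
      simpa using hab
    exact ⟨(LinearEquiv.ofInjectiveOfFinrankEq _ hinj (by simp)).toContinuousLinearEquiv, rfl⟩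
  have hζL : HasFDerivAt ζ (L : ℝ × ℝ →L[ℝ] ℂ) p :=
    hL ▸ (hζ.differentiableAt two_ne_zero).hasFDerivAt
  have hζs := hζ.hasStrictFDerivAt' hζL two_ne_zero
  set ψ := hζ.localInverse hζL two_ne_zero
  have hψ : ContDiffAt ℝ 1 ψ (ζ p) := (hζ.to_localInverse hζL two_ne_zero).of_le one_le_two
  have hψp : ψ (ζ p) = p := hζs.localInverse_apply_image
  have hψζ : ∀ᶠ x in 𝓝 p, ψ (ζ x) = x := hζs.eventually_left_inverse
  have hζψ : ∀ᶠ z in 𝓝 (ζ p), ζ (ψ z) = z := hζs.eventually_right_inverse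
  have hζt : Tendsto ζ (𝓝 p) (𝓝 (ζ p)) := hζ.continuousAt
  have hψt : Tendsto ψ (𝓝 (ζ p)) (𝓝 p) := by simpa [hψp] using hψ.continuousAt.tendsto
  have hcomp : ∀ {φ : ℝ × ℝ → ℂ}, ContDiffAt ℝ 1 φ p → ContDiffAt ℝ 1 (fun z => φ (ψ z)) (ζ p) :=
    fun h => ContDiffAt.comp (ζ p) (by rwa [hψp]) hψ
  have hW : ContDiffAt ℝ 1 (fun z => w (ψ z)) (ζ p) := hcomp hw
  have hWw : ∀ᶠ x in 𝓝 p, w (ψ (ζ x)) = w x := hψζ.mono fun x hx => by rw [hx]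
  let d : ℝ × ℝ → ℂ := fun x =>
    (starRingEnd ℂ (μ x) - μ x) * starRingEnd ℂ (fderiv ℝ ζ x (0, 1))
  have hμc : ContDiffAt ℝ 1 μ p := hμ.contDiffAt.of_le le_top
  have hd : ContDiffAt ℝ 1 d p := by
    refine ContDiffAt.mul (ContDiffAt.sub ?_ hμc) ?_
    · exact Complex.conjCLE.contDiff.contDiffAt.comp p hμc
    · exact Complex.conjCLE.contDiff.contDiffAt.comp p
        ((hζ.fderiv_right (m := 1) (by norm_num)).clm_apply contDiffAt_const)
  have hdp : d p ≠ 0 := by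
    simp only [d, hζp, map_one, mul_one]
    intro h
    have := congrArg Complex.im h
    simp only [Complex.sub_im, Complex.conj_im, Complex.zero_im] at this
    exact hμp (by linarith)
  let κ : ℝ × ℝ → ℂ := fun x => 2 * (d x)⁻¹
  have hκ : ContDiffAt ℝ 1 κ p := contDiffAt_const.mul (hd.inv hdp)
  have hdbar : ∀ᶠ x in 𝓝 p, dbar (fun z => w (ψ z)) (ζ x) = κ x * g x := by
    have hWd : ∀ᶠ z in 𝓝 (ζ p), DifferentiableAt ℝ (fun z => w (ψ z)) z :=
      (hW.eventually (by simp)).mono fun z hz => hz.differentiableAt one_ne_zero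
    have hζd : ∀ᶠ x in 𝓝 p, DifferentiableAt ℝ ζ x :=
      (hζ.eventually (by simp)).mono fun z hz => hz.differentiableAt two_ne_zero
    filter_upwards [hζt.eventually hWd, hζd, hWw.eventually_nhds, hζe, hwg,
      hd.continuousAt.eventually_ne hdp] with x h1 h2 h3 h4 h5 h6
    have h7 := (h1.hasFDerivAt.comp x h2.hasFDerivAt).congr_of_eventuallyEq
      (h3.mono fun y hy => hy.symm)
    have h8 : dbar (fun z => w (ψ z)) (ζ x) / 2 * d x = g x := by
      rw [← h5, h7.fderiv]
      simp only [ContinuousLinearMap.comp_apply, h4]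
      exact apply_sub_mul_apply_eq_dbar.symm
    simp only [κ, ← h8]
    field_simp
  have hκb : ∀ᶠ x in 𝓝 p, ‖κ x‖ ≤ ‖κ p‖ + 1 :=
    (hκ.continuousAt.norm.eventually_lt_const (lt_add_one _)).mono fun x hx => hx.le
  have key := eventually_eq_zero_or_eventually_ne_zero_of_norm_dbar_le
    (W := fun z => w (ψ z)) (G := fun z => κ (ψ z) * g (ψ z)) (c := ζ p)
    (M := (‖κ p‖ + 1) * M) (by positivity) hW (hcomp (hκ.mul hg))
    (by filter_upwards [hψt.eventually hdbar, hζψ] with z h1 h2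
        rwa [h2] at h1)
    (by filter_upwards [hψt.eventually hκb, hψt.eventually hgw] with z h1 h2
        rw [norm_mul, mul_assoc]
        gcongr)
  refine key.imp (fun h => ?_) fun h => ?_
  · filter_upwards [hζt.eventually h, hWw] with x h1 h2
    rwa [← h2]
  · have hne : Tendsto ζ (𝓝[≠] p) (𝓝[≠] (ζ p)) := by
      refine tendsto_nhdsWithin_of_tendsto_nhds_of_eventually_within _
        (hζt.mono_left nhdsWithin_le_nhds) ?_
      filter_upwards [self_mem_nhdsWithin, nhdsWithin_le_nhds hψζ] with x hx h1 h2
      rw [h2, hψp] at h1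
      exact hx h1.symm
    filter_upwards [hne.eventually h, nhdsWithin_le_nhds hWw] with x h1 h2
    rwa [← h2]

theorem ContDiffAt.pd1 {f : ℝ × ℝ → ℝ} {x : ℝ × ℝ} (hf : ContDiffAt ℝ 2 f x) :
    ContDiffAt ℝ 1 (pd1 f) x :=
  (hf.fderiv_right (m := 1) (by norm_num)).clm_apply contDiffAt_const

theorem ContDiffAt.pd2 {f : ℝ × ℝ → ℝ} {x : ℝ × ℝ} (hf : ContDiffAt ℝ 2 f x) :
    ContDiffAt ℝ 1 (pd2 f) x :=
  (hf.fderiv_right (m := 1) (by norm_num)).clm_apply contDiffAt_const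

theorem AnalyticAt.pd1 {f : ℝ × ℝ → ℝ} {x : ℝ × ℝ} (hf : AnalyticAt ℝ f x) :
    AnalyticAt ℝ (pd1 f) x :=
  ((ContinuousLinearMap.apply ℝ ℝ ((1, 0) : ℝ × ℝ)).analyticAt _).comp hf.fderiv

theorem AnalyticAt.pd2 {f : ℝ × ℝ → ℝ} {x : ℝ × ℝ} (hf : AnalyticAt ℝ f x) :
    AnalyticAt ℝ (pd2 f) x :=
  ((ContinuousLinearMap.apply ℝ ℝ ((0, 1) : ℝ × ℝ)).analyticAt _).comp hf.fderiv

theorem ContDiffAt.pd1_pd2_eq {f : ℝ × ℝ → ℝ} {x : ℝ × ℝ} (hf : ContDiffAt ℝ 2 f x) :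
    _root_.pd1 (_root_.pd2 f) x = _root_.pd2 (_root_.pd1 f) x := by
  have hd : DifferentiableAt ℝ (fderiv ℝ f) x :=
    (hf.fderiv_right (m := 1) (by norm_num)).differentiableAt one_ne_zero
  have h : ∀ v w : ℝ × ℝ, fderiv ℝ (fun y => fderiv ℝ f y w) x v = fderiv ℝ (fderiv ℝ f) x v w := by
    intro v w
    rw [(hd.hasFDerivAt.clm_apply (hasFDerivAt_const w x)).fderiv]
    simp
  have hs := hf.isSymmSndFDerivAt (by simp)
  exact (h _ _).trans ((hs _ _).trans (h _ _).symm)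

/-- Dichotomy for the gradient of a solution of `p₁_x - 2 A p₁_y + (A² + B²) p₂_y = c₁ p₁ + c₂ p₂`,
where `(p₁, p₂)` is the gradient. -/
theorem eventually_critical_or_eventually_not_critical {f A B c₁ c₂ : ℝ × ℝ → ℝ} {p : ℝ × ℝ}
    (hf : ContDiffAt ℝ 2 f p) (hA : AnalyticAt ℝ A p) (hB : AnalyticAt ℝ B p) (hBp : B p ≠ 0)
    (hc₁ : AnalyticAt ℝ c₁ p) (hc₂ : AnalyticAt ℝ c₂ p)
    (heq : ∀ᶠ x in 𝓝 p, pd1 (pd1 f) x - 2 * A x * pd2 (pd1 f) x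
      + (A x ^ 2 + B x ^ 2) * pd2 (pd2 f) x = c₁ x * pd1 f x + c₂ x * pd2 f x) :
    (∀ᶠ x in 𝓝 p, pd1 f x = 0 ∧ pd2 f x = 0) ∨
      ∀ᶠ x in 𝓝[≠] p, ¬ (pd1 f x = 0 ∧ pd2 f x = 0) := by
  let pair : (ℝ × ℝ → ℝ) → (ℝ × ℝ → ℝ) → ℝ × ℝ → ℂ := fun u v x => u x + v x * Complex.I
  have hpair : ∀ {n : WithTop ℕ∞} {u v : ℝ × ℝ → ℝ}, ContDiffAt ℝ n u p → ContDiffAt ℝ n v p →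
      ContDiffAt ℝ n (pair u v) p := fun hu hv =>
    (Complex.ofRealCLM.contDiff.contDiffAt.comp p hu).add
      ((Complex.ofRealCLM.contDiff.contDiffAt.comp p hv).mul contDiffAt_const)
  have hfd : ∀ {u v : ℝ × ℝ → ℝ} {x : ℝ × ℝ} {u' v' : ℝ × ℝ →L[ℝ] ℝ}, HasFDerivAt u u' x →
      HasFDerivAt v v' x → ∀ h, fderiv ℝ (pair u v) x h = u' h + v' h * Complex.I := by
    intro u v x u' v' hu hv h
    have h1 := (Complex.ofRealCLM.hasFDerivAt.comp x hu).add
      ((Complex.ofRealCLM.hasFDerivAt.comp x hv).mul_const Complex.I)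
    have h2 : fderiv ℝ (pair u v) x = _ := h1.fderiv
    rw [h2]
    simp [mul_comm]
  let c₃ : ℝ × ℝ → ℝ := fun x => c₂ x - pd1 A x + A x * pd2 A x + B x * pd2 B x
  let c₄ : ℝ × ℝ → ℝ := fun x => pd1 B x - A x * pd2 B x + B x * pd2 A x
  have hc₃ : AnalyticAt ℝ c₃ p := ((hc₂.sub hA.pd1).add (hA.mul hA.pd2)).add (hB.mul hB.pd2)
  have hc₄ : AnalyticAt ℝ c₄ p := (hB.pd1.sub (hA.mul hB.pd2)).add (hB.mul hA.pd2)
  have hA1 : ContDiffAt ℝ 1 A p := hA.contDiffAt.of_le le_top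
  have hB1 : ContDiffAt ℝ 1 B p := hB.contDiffAt.of_le le_top
  let w := pair (fun x => pd1 f x - A x * pd2 f x) fun x => B x * pd2 f x
  let g := pair (fun x => c₁ x * pd1 f x + c₃ x * pd2 f x) fun x => c₄ x * pd2 f x
  have hBe : ∀ᶠ x in 𝓝 p, B x ≠ 0 := hB.continuousAt.eventually_ne hBp
  have hwre : ∀ x, (w x).re = pd1 f x - A x * pd2 f x := fun x => by simp [w, pair]
  have hwim : ∀ x, (w x).im = B x * pd2 f x := fun x => by simp [w, pair]
  have hw0 : ∀ x, B x ≠ 0 → (w x = 0 ↔ pd1 f x = 0 ∧ pd2 f x = 0) := by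
    intro x hx
    rw [Complex.ext_iff, hwre, hwim, Complex.zero_re, Complex.zero_im, mul_eq_zero, or_iff_right hx]
    constructor
    · rintro ⟨h1, h2⟩
      exact ⟨by simpa [h2] using h1, h2⟩
    · rintro ⟨h1, h2⟩
      simp [h1, h2]
  let N : ℝ × ℝ → ℝ := fun x =>
    |c₁ x| * (1 + |A x| / |B x|) + |c₃ x| / |B x| + |c₄ x| / |B x|
  have hNc : ContinuousAt N p := by
    have h1 := hA.continuousAt.abs
    have h2 := hB.continuousAt.abs
    have h3 : |B p| ≠ 0 := abs_ne_zero.2 hBp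
    exact ((hc₁.continuousAt.abs.mul (continuousAt_const.add (h1.div h2 h3))).add
      (hc₃.continuousAt.abs.div h2 h3)).add (hc₄.continuousAt.abs.div h2 h3)
  have key := AnalyticAt.eventually_eq_zero_or_eventually_ne_zero_of_beltrami
    (μ := pair A B) (w := w) (g := g) (p := p) (M := N p + 1) (by positivity)
    (hpair hA.contDiffAt hB.contDiffAt).analyticAt (by simpa [pair] using hBp)
    (hpair (hf.pd1.sub (hA1.mul hf.pd2)) (hB1.mul hf.pd2))
    (hpair (((hc₁.contDiffAt.of_le le_top).mul hf.pd1).add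
      ((hc₃.contDiffAt.of_le le_top).mul hf.pd2)) ((hc₄.contDiffAt.of_le le_top).mul hf.pd2)) ?_ ?_
  · refine key.imp (fun h => ?_) fun h => ?_
    · filter_upwards [h, hBe] with x h1 h2
      exact (hw0 x h2).1 h1
    · filter_upwards [h, nhdsWithin_le_nhds hBe] with x h1 h2
      exact fun h3 => h1 ((hw0 x h2).2 h3)
  · filter_upwards [heq, hf.eventually (by simp), hA1.eventually (by simp),
      hB1.eventually (by simp)]
      with x h1 h2 h3 h4
    have d1 := (h2.pd1.differentiableAt one_ne_zero).hasFDerivAt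
    have d2 := (h2.pd2.differentiableAt one_ne_zero).hasFDerivAt
    have dA := (h3.differentiableAt one_ne_zero).hasFDerivAt
    have dB := (h4.differentiableAt one_ne_zero).hasFDerivAt
    have hw := hfd (d1.sub (dA.mul d2)) (dB.mul d2)
    have e : fderiv ℝ (pd2 f) x (1, 0) = fderiv ℝ (pd1 f) x (0, 1) := h2.pd1_pd2_eq
    have hw' : ∀ h, fderiv ℝ w x h = _ := hw
    rw [hw', hw']
    simp only [_root_.sub_apply, _root_.add_apply,
      _root_.smul_apply, smul_eq_mul, g, pair, c₃, c₄]
    have h1' : ((_ : ℝ) : ℂ) = _ := congrArg Complex.ofReal h1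
    simp only [pd1, pd2] at h1' ⊢
    rw [e]
    push_cast at h1' ⊢
    linear_combination h1' - (B x : ℂ) * (B x * fderiv ℝ (pd2 f) x (0, 1)
      + fderiv ℝ f x (0, 1) * fderiv ℝ B x (0, 1)) * Complex.I_sq
  · filter_upwards [hNc.eventually_lt_const (lt_add_one _), hBe] with x h1 h2
    have hB0 : 0 < |B x| := abs_pos.2 h2
    have e2 : |pd2 f x| ≤ ‖w x‖ / |B x| := by
      rw [le_div_iff₀ hB0, mul_comm, ← abs_mul, ← hwim]
      exact Complex.abs_im_le_norm _
    have e1 : |pd1 f x| ≤ ‖w x‖ + |A x| * (‖w x‖ / |B x|) := by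
      have : pd1 f x = (w x).re + A x * pd2 f x := by rw [hwre]; ring
      rw [this]
      refine (abs_add_le _ _).trans (add_le_add (Complex.abs_re_le_norm _) ?_)
      rw [abs_mul]
      gcongr
    have e3 : ‖g x‖ ≤ |c₁ x| * |pd1 f x| + |c₃ x| * |pd2 f x| + |c₄ x| * |pd2 f x| := by
      refine (norm_add_le _ _).trans (add_le_add ?_ ?_)
      · rw [Complex.norm_real, Real.norm_eq_abs, ← abs_mul, ← abs_mul]
        exact abs_add_le _ _
      · simp
    calc ‖g x‖ ≤ _ := e3
      _ ≤ |c₁ x| * (‖w x‖ + |A x| * (‖w x‖ / |B x|)) + |c₃ x| * (‖w x‖ / |B x|)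
          + |c₄ x| * (‖w x‖ / |B x|) := by gcongr
      _ = N x * ‖w x‖ := by simp only [N]; ring
      _ ≤ (N p + 1) * ‖w x‖ := by gcongr

theorem fderiv_eq_zero_iff_pd {f : ℝ × ℝ → ℝ} {x : ℝ × ℝ} :
    fderiv ℝ f x = 0 ↔ pd1 f x = 0 ∧ pd2 f x = 0 := by
  refine ⟨fun h => by simp [pd1, pd2, h], fun ⟨h1, h2⟩ => ?_⟩
  ext
  · simpa using! h1
  · simpa using! h2

/-- Dichotomy for the gradient of a solution of an elliptic equation without zero-order term. -/
theorem eventually_critical_or_eventually_not_critical_of_elliptic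
    {a11 a12 a22 b1 b2 f : ℝ × ℝ → ℝ} {p : ℝ × ℝ}
    (ha11 : AnalyticAt ℝ a11 p) (ha12 : AnalyticAt ℝ a12 p) (ha22 : AnalyticAt ℝ a22 p)
    (hb1 : AnalyticAt ℝ b1 p) (hb2 : AnalyticAt ℝ b2 p)
    (h11 : 0 < a11 p) (hdisc : a12 p ^ 2 < a11 p * a22 p) (hf : ContDiffAt ℝ 2 f p)
    (heq : ∀ᶠ x in 𝓝 p, a11 x * pd1 (pd1 f) x + 2 * a12 x * pd2 (pd1 f) x
      + a22 x * pd2 (pd2 f) x + b1 x * pd1 f x + b2 x * pd2 f x = 0) :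
    (∀ᶠ x in 𝓝 p, pd1 f x = 0 ∧ pd2 f x = 0) ∨
      ∀ᶠ x in 𝓝[≠] p, ¬ (pd1 f x = 0 ∧ pd2 f x = 0) := by
  have hd : AnalyticAt ℝ (fun x => a11 x * a22 x - a12 x ^ 2) p := (ha11.mul ha22).sub (ha12.pow 2)
  have hdp : 0 < a11 p * a22 p - a12 p ^ 2 := sub_pos.2 hdisc
  have hsqrt : AnalyticAt ℝ (fun x => √(a11 x * a22 x - a12 x ^ 2)) p :=
    (Real.contDiffAt_sqrt hdp.ne').analyticAt.fun_comp (f := fun x => a11 x * a22 x - a12 x ^ 2) hd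
  refine eventually_critical_or_eventually_not_critical hf (ha12.neg.div ha11 h11.ne')
    (hsqrt.div ha11 h11.ne') (div_ne_zero (Real.sqrt_pos.2 hdp).ne' h11.ne')
    (hb1.neg.div ha11 h11.ne') (hb2.neg.div ha11 h11.ne') ?_
  filter_upwards [heq, ha11.continuousAt.eventually_ne h11.ne',
    hd.continuousAt.eventually_const_lt hdp] with x hx hx11 hxd
  simp only [Pi.div_apply, Pi.neg_apply, div_pow, Real.sq_sqrt hxd.le]
  field_simp
  linear_combination a11 x * hx

theorem IsPreconnected.forall_or_forall_eventually_not {X : Type*} [TopologicalSpace X] [T1Space X]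
    [∀ x : X, (𝓝[≠] x).NeBot] {Ω : Set X} (hΩ : IsPreconnected Ω) {P : X → Prop}
    (h : ∀ p ∈ Ω, (∀ᶠ x in 𝓝 p, P x) ∨ ∀ᶠ x in 𝓝[≠] p, ¬ P x) :
    (∀ x ∈ Ω, P x) ∨ ∀ p ∈ Ω, ∀ᶠ x in 𝓝[≠] p, ¬ P x := by
  by_cases hne : ∃ p ∈ Ω, ∀ᶠ x in 𝓝 p, P x
  swap
  · exact Or.inr fun p hp => (h p hp).resolve_left fun hP => hne ⟨p, hp, hP⟩
  obtain ⟨p₀, hp₀, hP₀⟩ := hne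
  have hcl : closure {x | ∀ᶠ y in 𝓝 x, P y} ∩ Ω ⊆ {x | ∀ᶠ y in 𝓝 x, P y} := by
    rintro p ⟨hpS, hp⟩
    refine (h p hp).resolve_right fun hP => ?_
    obtain ⟨U, hU, hUo, hpU⟩ := _root_.eventually_nhds_iff.1 (eventually_nhdsWithin_iff.1 hP)
    obtain ⟨x, hxU, hxS⟩ := mem_closure_iff.1 hpS U hUo hpU
    have hx : ∀ᶠ y in 𝓝[≠] x, P y ∧ y ∈ U :=
      (Filter.Eventually.and hxS (hUo.mem_nhds hxU)).filter_mono nhdsWithin_le_nhds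
    have hne : ∀ᶠ y in 𝓝[≠] x, y ≠ p := by
      by_cases hxp : x = p
      · subst hxp
        exact self_mem_nhdsWithin
      · exact mem_nhdsWithin_of_mem_nhds (isOpen_ne.mem_nhds hxp)
    obtain ⟨y, ⟨hy1, hy2⟩, hy3⟩ := (hx.and hne).exists
    exact hU y hy2 hy3 hy1
  exact Or.inl fun x hx => (hΩ.subset_of_closure_inter_subset isOpen_setOfPred_eventually_nhds
    ⟨p₀, hp₀, hP₀⟩ hcl hx).self_of_nhds

end

/-- Every critical point of a nonconstant solution of a homogeneous quasilinear elliptic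
equation with real-analytic coefficients and no zero-order term is an isolated critical
point. -/
theorem critical_points_isolated
    (Ω : Set (ℝ × ℝ)) (hΩo : IsOpen Ω) (hΩc : IsConnected Ω)
    (a11 a12 a22 b1 b2 : ℝ × ℝ → ℝ)
    (ha11 : AnalyticOnNhd ℝ a11 Ω) (ha12 : AnalyticOnNhd ℝ a12 Ω)
    (ha22 : AnalyticOnNhd ℝ a22 Ω)
    (hb1 : AnalyticOnNhd ℝ b1 Ω) (hb2 : AnalyticOnNhd ℝ b2 Ω)
    (hell1 : ∀ x ∈ Ω, 0 < a11 x) (hell2 : ∀ x ∈ Ω, (a12 x)^2 < a11 x * a22 x)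
    (f : ℝ × ℝ → ℝ) (hf : ContDiffOn ℝ 2 f Ω)
    (heq : ∀ x ∈ Ω, a11 x * pd1 (pd1 f) x + 2 * a12 x * pd2 (pd1 f) x
      + a22 x * pd2 (pd2 f) x + b1 x * pd1 f x + b2 x * pd2 f x = 0)
    (hnonconst : ¬ ∃ c : ℝ, ∀ x ∈ Ω, f x = c) :
    ∀ p ∈ Ω, (pd1 f p = 0 ∧ pd2 f p = 0) →
      ∃ ε > 0, ∀ x ∈ Metric.ball p ε ∩ Ω, x ≠ p → ¬ (pd1 f x = 0 ∧ pd2 f x = 0) := by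
  intro p hp _
  have hdich := hΩc.isPreconnected.forall_or_forall_eventually_not
    (P := fun x => pd1 f x = 0 ∧ pd2 f x = 0) fun p hp =>
      eventually_critical_or_eventually_not_critical_of_elliptic (ha11 p hp) (ha12 p hp) (ha22 p hp)
        (hb1 p hp) (hb2 p hp) (hell1 p hp) (hell2 p hp) (hf.contDiffAt (hΩo.mem_nhds hp))
        (Filter.eventually_of_mem (hΩo.mem_nhds hp) heq)
  have hisol := hdich.resolve_left fun h => hnonconst <|
    hΩo.exists_is_const_of_fderiv_eq_zero hΩc.isPreconnected (hf.differentiableOn two_ne_zero)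
      fun x hx => fderiv_eq_zero_iff_pd.2 (h x hx)
  obtain ⟨ε, hε, hball⟩ := Metric.eventually_nhds_iff.1 (eventually_nhdsWithin_iff.1 (hisol p hp))
  exact ⟨ε, hε, fun x hx hxp => hball hx.1 hxp⟩
end

section
/- Let Ω ⊂ ℝ² be a bounded open convex domain, H > 0 a constant, and let v be a solution, smooth up to the closure of Ω, of Δv = 2H on Ω with v = 0 on ∂Ω. Then at every critical point p ∈ Ω of v (∇v(p) = 0), the Hessian determinant v_xx(p)v_yy(p) − v_xy(p)² is strictly positive; in particular every critical point of v is a local minimum point with negative Gaussian curvature of the graph. -/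
open Real Set

open Filter Topology

/-- The linear form on the plane with coefficients `a` and `b`. -/
noncomputable def planeForm (a b : ℝ) : ℝ × ℝ →L[ℝ] ℝ :=
  a • ContinuousLinearMap.fst ℝ ℝ ℝ + b • ContinuousLinearMap.snd ℝ ℝ ℝ

@[simp] lemma planeForm_apply (a b : ℝ) (d : ℝ × ℝ) : planeForm a b d = a * d.1 + b * d.2 := by
  simp [planeForm]

lemma eq_planeForm (L : ℝ × ℝ →L[ℝ] ℝ) : L = planeForm (L (1, 0)) (L (0, 1)) := by
  ext <;> simp

section PlaneCalculus

variable {f g : ℝ × ℝ → ℝ} {a b c d : ℝ} {x : ℝ × ℝ} {s : Set (ℝ × ℝ)}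

lemma HasFDerivAt.planeForm_add (hf : HasFDerivAt f (planeForm a b) x)
    (hg : HasFDerivAt g (planeForm c d) x) :
    HasFDerivAt (fun y => f y + g y) (planeForm (a + c) (b + d)) x :=
  (hf.fun_add hg).congr_fderiv (by ext <;> simp)

lemma HasFDerivAt.planeForm_sub (hf : HasFDerivAt f (planeForm a b) x)
    (hg : HasFDerivAt g (planeForm c d) x) :
    HasFDerivAt (fun y => f y - g y) (planeForm (a - c) (b - d)) x :=
  (hf.fun_sub hg).congr_fderiv (by ext <;> simp)

lemma HasFDerivAt.planeForm_mul (hf : HasFDerivAt f (planeForm a b) x)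
    (hg : HasFDerivAt g (planeForm c d) x) :
    HasFDerivAt (fun y => f y * g y) (planeForm (a * g x + f x * c) (b * g x + f x * d)) x :=
  (hf.fun_mul hg).congr_fderiv (by ext <;> simp <;> ring)

lemma hasFDerivAt_planeForm_const (k : ℝ) (x : ℝ × ℝ) :
    HasFDerivAt (fun _ : ℝ × ℝ => k) (planeForm 0 0) x :=
  (hasFDerivAt_const k x).congr_fderiv (by ext <;> simp)

lemma HasFDerivAt.planeForm_congr (hf : HasFDerivAt f (planeForm a b) x) (h₁ : a = c)
    (h₂ : b = d) : HasFDerivAt f (planeForm c d) x := h₁ ▸ h₂ ▸ hf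

/-- Derivative along a line of a function of two variables, within a set of parameters. -/
lemma HasFDerivWithinAt.hasDerivWithinAt_line {p e : ℝ × ℝ} {t : ℝ} {u : Set ℝ}
    (hf : HasFDerivWithinAt f (planeForm a b) s (p + t • e))
    (hu : ∀ r ∈ u, p + r • e ∈ s) :
    HasDerivWithinAt (fun r : ℝ => f (p + r • e)) (a * e.1 + b * e.2) u t := by
  have h : HasDerivWithinAt (fun r : ℝ => p + r • e) e u t := by
    simpa using (((hasDerivAt_id t).smul_const e).const_add p).hasDerivWithinAt
  exact (hf.comp_hasDerivWithinAt t h hu).congr_deriv (by simp)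

/-- Derivative along a line of a function of two variables. -/
lemma HasFDerivAt.hasDerivAt_line {p e : ℝ × ℝ} {t : ℝ}
    (hf : HasFDerivAt f (planeForm a b) (p + t • e)) :
    HasDerivAt (fun r : ℝ => f (p + r • e)) (a * e.1 + b * e.2) t := by
  have h : HasDerivAt (fun r : ℝ => p + r • e) e t := by
    simpa using ((hasDerivAt_id t).smul_const e).const_add p
  exact (hf.comp_hasDerivAt t h).congr_deriv (by simp)

/-- Equality of mixed partial derivatives. -/
lemma mixed_partials_eq {f₁ f₂ : ℝ × ℝ → ℝ} {a b c d : ℝ}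
    (hf : ∀ᶠ y in 𝓝 x, HasFDerivAt f (planeForm (f₁ y) (f₂ y)) y)
    (h₁ : HasFDerivAt f₁ (planeForm a b) x) (h₂ : HasFDerivAt f₂ (planeForm c d) x) : b = c := by
  have h := (h₁.smul_const (ContinuousLinearMap.fst ℝ ℝ ℝ)).add
    (h₂.smul_const (ContinuousLinearMap.snd ℝ ℝ ℝ))
  have := second_derivative_symmetric_of_eventually (f' := fun y => planeForm (f₁ y) (f₂ y)) hf h
    (0, 1) (1, 0)
  simpa using this

/-- Smooth partial derivatives within a set of unique differentiability. -/
lemma ContDiffOn.exists_partials (hs : UniqueDiffOn ℝ s) (hf : ContDiffOn ℝ (⊤ : ℕ∞) f s) :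
    ∃ f₁ f₂ : ℝ × ℝ → ℝ, ContDiffOn ℝ (⊤ : ℕ∞) f₁ s ∧ ContDiffOn ℝ (⊤ : ℕ∞) f₂ s ∧
      ∀ y ∈ s, HasFDerivWithinAt f (planeForm (f₁ y) (f₂ y)) s y := by
  have h : ContDiffOn ℝ (⊤ : ℕ∞) (fderivWithin ℝ f s) s := hf.fderivWithin hs (by simp)
  refine ⟨fun y => fderivWithin ℝ f s y (1, 0), fun y => fderivWithin ℝ f s y (0, 1),
    h.clm_apply contDiffOn_const, h.clm_apply contDiffOn_const, fun y hy => ?_⟩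
  rw [← eq_planeForm]
  exact (hf.differentiableOn (by simp) y hy).hasFDerivWithinAt

end PlaneCalculus

/-- Second-order necessary condition for a local minimum of a function of one variable. -/
lemma IsLocalMin.second_deriv_nonneg {φ φ' : ℝ → ℝ} {c t : ℝ} (h : IsLocalMin φ t)
    (hφ : ∀ᶠ r in 𝓝 t, HasDerivAt φ (φ' r) r) (hφ' : HasDerivAt φ' c t) : 0 ≤ c := by
  by_contra! hc
  have he : deriv φ =ᶠ[𝓝 t] φ' := hφ.mono fun r hr => hr.deriv
  have hmax := isLocalMax_of_deriv_deriv_neg (by rwa [he.deriv_eq, hφ'.deriv]) h.deriv_eq_zero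
    hφ.self_of_nhds.continuousAt
  have hconst : φ =ᶠ[𝓝 t] fun _ => φ t := by
    filter_upwards [h, hmax] with r h₁ h₂ using le_antisymm h₂ h₁
  have h0 : deriv φ =ᶠ[𝓝 t] fun _ => 0 := by
    simpa using hconst.deriv
  have := (he.symm.trans h0).deriv_eq
  rw [hφ'.deriv] at this
  simp at this
  linarith

/-- At a local minimum of a function of two variables the Laplacian is nonnegative. -/
lemma IsLocalMin.laplacian_nonneg {f f₁ f₂ : ℝ × ℝ → ℝ} {a b c d : ℝ} {x : ℝ × ℝ}
    (h : IsLocalMin f x) (hf : ∀ᶠ y in 𝓝 x, HasFDerivAt f (planeForm (f₁ y) (f₂ y)) y)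
    (h₁ : HasFDerivAt f₁ (planeForm a b) x) (h₂ : HasFDerivAt f₂ (planeForm c d) x) :
    0 ≤ a + d := by
  have hl : ∀ e : ℝ × ℝ, Tendsto (fun t : ℝ => x + t • e) (𝓝 0) (𝓝 x) := fun e => by
    have : Continuous fun t : ℝ => x + t • e := by fun_prop
    simpa using this.tendsto 0
  have key : ∀ e : ℝ × ℝ, 0 ≤ (a * e.1 + b * e.2) * e.1 + (c * e.1 + d * e.2) * e.2 := fun e => by
    refine IsLocalMin.second_deriv_nonneg (φ := fun t => f (x + t • e))
      (φ' := fun t => f₁ (x + t • e) * e.1 + f₂ (x + t • e) * e.2) (t := 0) ?_ ?_ ?_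
    · simpa [IsLocalMin, IsMinFilter] using (hl e).eventually h
    · filter_upwards [(hl e).eventually hf] with t ht using ht.hasDerivAt_line
    · exact ((HasFDerivAt.hasDerivAt_line (by simpa using h₁)).mul_const _).add
        ((HasFDerivAt.hasDerivAt_line (by simpa using h₂)).mul_const _)
  have e₁ := key (1, 0)
  have e₂ := key (0, 1)
  simp at e₁ e₂
  linarith

/-- Minimum principle: a function without interior local minima is positive
if it is nonnegative on the boundary. -/
lemma pos_of_frontier_nonneg {f : ℝ × ℝ → ℝ} {Ω : Set (ℝ × ℝ)} (hΩo : IsOpen Ω)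
    (hΩb : Bornology.IsBounded Ω) (hf : ContinuousOn f (closure Ω))
    (hbd : ∀ x ∈ frontier Ω, 0 ≤ f x) (hmin : ∀ x ∈ Ω, ¬ IsLocalMin f x) :
    ∀ x ∈ Ω, 0 < f x := by
  intro x hx
  obtain ⟨m, hm, hle⟩ := hΩb.isCompact_closure.exists_isMinOn ⟨x, subset_closure hx⟩ hf
  have hnot : ∀ y ∈ Ω, f y ≠ f m := fun y hy hyz => hmin y hy <| by
    filter_upwards [hΩo.mem_nhds hy] with z hz
    exact hyz ▸ hle (subset_closure hz)
  have hm' : m ∈ frontier Ω := by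
    rw [hΩo.frontier_eq]
    exact ⟨hm, fun hmΩ => hnot m hmΩ rfl⟩
  exact lt_of_le_of_ne ((hbd m hm').trans (hle (subset_closure hx)))
    fun h0 => hnot x hx (le_antisymm (h0 ▸ hbd m hm') (hle (subset_closure hx)))

/-- Two successive applications of the mean value theorem. -/
lemma exists_mean_value_second {φ φ₁ φ₂ : ℝ → ℝ}
    (h : ∀ t ∈ Icc (0 : ℝ) 1, HasDerivWithinAt φ (φ₁ t) (Icc 0 1) t)
    (h₁ : ∀ t ∈ Icc (0 : ℝ) 1, HasDerivWithinAt φ₁ (φ₂ t) (Icc 0 1) t) :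
    ∃ s ∈ Ioo (0 : ℝ) 1, ∃ r ∈ Ioo (0 : ℝ) 1,
      φ 1 - φ 0 = φ₁ s ∧ φ₁ s - φ₁ 0 = s * φ₂ r := by
  have up : ∀ {ψ ψ' : ℝ → ℝ}, (∀ t ∈ Icc (0 : ℝ) 1, HasDerivWithinAt ψ (ψ' t) (Icc 0 1) t) →
      ∀ t ∈ Ioo (0 : ℝ) 1, HasDerivAt ψ (ψ' t) t := fun hψ t ht =>
    (hψ t (Ioo_subset_Icc_self ht)).hasDerivAt (Icc_mem_nhds ht.1 ht.2)
  obtain ⟨s, hs, hs'⟩ := exists_hasDerivAt_eq_slope φ φ₁ one_pos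
    (fun t ht => (h t ht).continuousWithinAt) (up h)
  obtain ⟨r, hr, hr'⟩ := exists_hasDerivAt_eq_slope φ₁ φ₂ hs.1
    (fun t ht => ((h₁ t ⟨ht.1, ht.2.trans hs.2.le⟩).continuousWithinAt).mono
      (Icc_subset_Icc_right hs.2.le)) (fun t ht => up h₁ t ⟨ht.1, ht.2.trans hs.2⟩)
  refine ⟨s, hs, r, ⟨hr.1, hr.2.trans hs.2⟩, by simp [hs'], ?_⟩
  rw [hr', sub_zero, mul_div_cancel₀ _ hs.1.ne']

/-- `v` solves `Δv = 2H` up to the boundary of `s`: its gradient is `(v₁, v₂)` and its Hessian is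
`H + A`, `B`, `H - A`, with continuous entries. -/
structure PoissonHessian (s : Set (ℝ × ℝ)) (H : ℝ) (v v₁ v₂ A B : ℝ × ℝ → ℝ) : Prop where
  hasGrad : ∀ x ∈ s, HasFDerivWithinAt v (planeForm (v₁ x) (v₂ x)) s x
  hasGrad_fst : ∀ x ∈ s, HasFDerivWithinAt v₁ (planeForm (H + A x) (B x)) s x
  hasGrad_snd : ∀ x ∈ s, HasFDerivWithinAt v₂ (planeForm (B x) (H - A x)) s x
  continuousOn_A : ContinuousOn A s
  continuousOn_B : ContinuousOn B s

/-- `A - iB` is holomorphic on `Ω` with derivative `α - iβ`, expressed in real terms. -/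
structure CauchyRiemannOn (Ω : Set (ℝ × ℝ)) (A B α β : ℝ × ℝ → ℝ) : Prop where
  re : ∀ x ∈ Ω, HasFDerivAt A (planeForm (α x) (β x)) x
  im : ∀ x ∈ Ω, HasFDerivAt B (planeForm (β x) (-α x)) x

/-- The Makar-Limanov function, a positive multiple of `v² det D²√(-v)`. -/
def makarLimanov (H : ℝ) (v v₁ v₂ A B : ℝ × ℝ → ℝ) (x : ℝ × ℝ) : ℝ :=
  -2 * (v x * (H * H - (A x * A x + B x * B x))) + H * (v₁ x * v₁ x + v₂ x * v₂ x)
    - A x * (v₁ x * v₁ x - v₂ x * v₂ x) - 2 * (B x * (v₁ x * v₂ x))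

section MakarLimanov

variable {Ω s : Set (ℝ × ℝ)} {H : ℝ} {v v₁ v₂ A B α β γ δ : ℝ × ℝ → ℝ} {x : ℝ × ℝ}

namespace PoissonHessian

lemma continuousOn (h : PoissonHessian s H v v₁ v₂ A B) : ContinuousOn v s :=
  fun x hx => (h.hasGrad x hx).continuousWithinAt

lemma continuousOn_fst (h : PoissonHessian s H v v₁ v₂ A B) : ContinuousOn v₁ s :=
  fun x hx => (h.hasGrad_fst x hx).continuousWithinAt

lemma continuousOn_snd (h : PoissonHessian s H v v₁ v₂ A B) : ContinuousOn v₂ s :=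
  fun x hx => (h.hasGrad_snd x hx).continuousWithinAt

lemma hasFDerivAt (h : PoissonHessian s H v v₁ v₂ A B)
    (hs : s ∈ 𝓝 x) : HasFDerivAt v (planeForm (v₁ x) (v₂ x)) x :=
  (h.hasGrad x (mem_of_mem_nhds hs)).hasFDerivAt hs

lemma hasFDerivAt_fst (h : PoissonHessian s H v v₁ v₂ A B)
    (hs : s ∈ 𝓝 x) : HasFDerivAt v₁ (planeForm (H + A x) (B x)) x :=
  (h.hasGrad_fst x (mem_of_mem_nhds hs)).hasFDerivAt hs

lemma hasFDerivAt_snd (h : PoissonHessian s H v v₁ v₂ A B)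
    (hs : s ∈ 𝓝 x) : HasFDerivAt v₂ (planeForm (B x) (H - A x)) x :=
  (h.hasGrad_snd x (mem_of_mem_nhds hs)).hasFDerivAt hs

lemma continuousOn_makarLimanov (h : PoissonHessian s H v v₁ v₂ A B) :
    ContinuousOn (makarLimanov H v v₁ v₂ A B) s := by
  have := h.continuousOn
  have := h.continuousOn_fst
  have := h.continuousOn_snd
  have := h.continuousOn_A
  have := h.continuousOn_B
  unfold makarLimanov
  fun_prop

/-- The gradient of the Makar-Limanov function. -/
lemma hasFDerivAt_makarLimanov (h : PoissonHessian s H v v₁ v₂ A B)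
    (hs : s ∈ 𝓝 x) (hA : HasFDerivAt A (planeForm (α x) (β x)) x)
    (hB : HasFDerivAt B (planeForm (β x) (-α x)) x) :
    HasFDerivAt (makarLimanov H v v₁ v₂ A B)
      (planeForm
        (α x * (4 * (v x * A x) - v₁ x * v₁ x + v₂ x * v₂ x)
          + β x * (4 * (v x * B x) - 2 * (v₁ x * v₂ x)))
        (β x * (4 * (v x * A x) - v₁ x * v₁ x + v₂ x * v₂ x)
          - α x * (4 * (v x * B x) - 2 * (v₁ x * v₂ x)))) x := by
  have hv := h.hasFDerivAt hs
  have h₁ := h.hasFDerivAt_fst hs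
  have h₂ := h.hasFDerivAt_snd hs
  have c := fun k => hasFDerivAt_planeForm_const k x
  exact ((((c (-2)).planeForm_mul (hv.planeForm_mul ((c (H * H)).planeForm_sub
    ((hA.planeForm_mul hA).planeForm_add (hB.planeForm_mul hB))))).planeForm_add
    ((c H).planeForm_mul ((h₁.planeForm_mul h₁).planeForm_add (h₂.planeForm_mul h₂)))).planeForm_sub
    (hA.planeForm_mul ((h₁.planeForm_mul h₁).planeForm_sub (h₂.planeForm_mul h₂)))).planeForm_sub
    ((c 2).planeForm_mul (hB.planeForm_mul (h₁.planeForm_mul h₂)))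
    |>.planeForm_congr (by ring) (by ring)

/-- A perturbation of the Makar-Limanov function has no interior local minimum. -/
lemma not_isLocalMin_makarLimanov (h : PoissonHessian s H v v₁ v₂ A B)
    (hΩo : IsOpen Ω) (hΩs : Ω ⊆ s)
    (hAB : CauchyRiemannOn Ω A B α β) (hαβ : CauchyRiemannOn Ω α β γ δ) (hH : 0 < H) (hx : x ∈ Ω)
    (hneg : v x ≤ 0) {ε : ℝ} (hε : 0 < ε) :
    ¬ IsLocalMin (fun y => makarLimanov H v v₁ v₂ A B y - ε * v y) x := by
  intro hmin
  have hs : ∀ y ∈ Ω, s ∈ 𝓝 y := fun y hy => mem_of_superset (hΩo.mem_nhds hy) hΩs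
  have hgrad : ∀ y ∈ Ω, HasFDerivAt (fun y => makarLimanov H v v₁ v₂ A B y - ε * v y) _ y :=
    fun y hy => (h.hasFDerivAt_makarLimanov (hs y hy) (hAB.re y hy) (hAB.im y hy)).planeForm_sub
      ((hasFDerivAt_planeForm_const ε y).planeForm_mul (h.hasFDerivAt (hs y hy)))
  have hv := h.hasFDerivAt (hs x hx)
  have h₁ := h.hasFDerivAt_fst (hs x hx)
  have h₂ := h.hasFDerivAt_snd (hs x hx)
  have hA := hAB.re x hx
  have hB := hAB.im x hx
  have hα := hαβ.re x hx
  have hβ := hαβ.im x hx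
  have c := fun k => hasFDerivAt_planeForm_const k x
  have hX := (((c 4).planeForm_mul (hv.planeForm_mul hA)).planeForm_sub
    (h₁.planeForm_mul h₁)).planeForm_add (h₂.planeForm_mul h₂)
  have hY := ((c 4).planeForm_mul (hv.planeForm_mul hB)).planeForm_sub
    ((c 2).planeForm_mul (h₁.planeForm_mul h₂))
  have hlap := hmin.laplacian_nonneg (eventually_of_mem (hΩo.mem_nhds hx) hgrad)
    (((hα.planeForm_mul hX).planeForm_add (hβ.planeForm_mul hY)).planeForm_sub
      (((c 0).planeForm_mul hv).planeForm_add ((c ε).planeForm_mul h₁)))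
    (((hβ.planeForm_mul hX).planeForm_sub (hα.planeForm_mul hY)).planeForm_sub
      (((c 0).planeForm_mul hv).planeForm_add ((c ε).planeForm_mul h₂)))
  have : 0 ≤ 8 * v x * (α x ^ 2 + β x ^ 2) - 2 * (ε * H) := by
    refine hlap.trans_eq ?_
    ring
  nlinarith [mul_pos hε hH, mul_nonneg (neg_nonneg.2 hneg)
    (add_nonneg (sq_nonneg (α x)) (sq_nonneg (β x)))]

/-- Second-order Taylor expansion along a segment, in mean value form. -/
lemma exists_taylor (h : PoissonHessian s H v v₁ v₂ A B)
    (hs : Convex ℝ s) {d : ℝ × ℝ} (hx : x ∈ s) (hd : x + d ∈ s) :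
    ∃ t ∈ Ioo (0 : ℝ) 1, ∃ r ∈ Ioo (0 : ℝ) 1, x + t • d ∈ s ∧ x + r • d ∈ s ∧
      v (x + d) - v x = v₁ (x + t • d) * d.1 + v₂ (x + t • d) * d.2 ∧
      v₁ (x + t • d) * d.1 + v₂ (x + t • d) * d.2 - (v₁ x * d.1 + v₂ x * d.2) =
        t * (((H + A (x + r • d)) * d.1 + B (x + r • d) * d.2) * d.1
          + (B (x + r • d) * d.1 + (H - A (x + r • d)) * d.2) * d.2) := by
  have hmem : ∀ t ∈ Icc (0 : ℝ) 1, x + t • d ∈ s := fun t ht => hs.add_smul_mem hx hd ht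
  obtain ⟨t, ht, r, hr, e₁, e₂⟩ := exists_mean_value_second
    (fun t ht => (h.hasGrad _ (hmem t ht)).hasDerivWithinAt_line hmem)
    (fun t ht => (((h.hasGrad_fst _ (hmem t ht)).hasDerivWithinAt_line hmem).mul_const d.1).add
      (((h.hasGrad_snd _ (hmem t ht)).hasDerivWithinAt_line hmem).mul_const d.2))
  exact ⟨t, ht, r, hr, hmem t (Ioo_subset_Icc_self ht), hmem r (Ioo_subset_Icc_self hr),
    by simpa using e₁, by simpa using e₂⟩

/-- A critical point with positive Hessian determinant is a local minimum. -/
lemma isLocalMin (h : PoissonHessian s H v v₁ v₂ A B)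
    (hs : Convex ℝ s) (hx : s ∈ 𝓝 x) (hH : 0 < H) (h₁ : v₁ x = 0) (h₂ : v₂ x = 0)
    (hdet : A x ^ 2 + B x ^ 2 < H ^ 2) : IsLocalMin v x := by
  have hA := h.continuousOn_A.continuousAt hx
  have hB := h.continuousOn_B.continuousAt hx
  have hev : ∀ᶠ y in 𝓝 x, A y ^ 2 + B y ^ 2 < H ^ 2 :=
    ((hA.pow 2).add (hB.pow 2)).eventually (eventually_lt_nhds hdet)
  obtain ⟨ε, hε, hball⟩ := Metric.eventually_nhds_iff_ball.1 (hev.and hx)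
  filter_upwards [Metric.ball_mem_nhds x hε] with y hy
  have hx0 : x ∈ Metric.ball x ε := Metric.mem_ball_self hε
  obtain ⟨t, ht, r, hr, -, -, e₁, e₂⟩ := h.exists_taylor hs (d := y - x) (mem_of_mem_nhds hx)
    (by rw [add_sub_cancel]; exact (hball y hy).2)
  have hz := (hball _ ((convex_ball x ε).add_smul_mem hx0 (y := y - x) (by simpa using hy)
    (Ioo_subset_Icc_self hr))).1
  rw [add_sub_cancel] at e₁
  rw [h₁, h₂] at e₂
  generalize A (x + r • (y - x)) = a at *
  generalize B (x + r • (y - x)) = b at *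
  generalize (y - x).1 = d₁ at *
  generalize (y - x).2 = d₂ at *
  have ha : 0 < H + a := by nlinarith [sq_nonneg b]
  have hq : 0 ≤ ((H + a) * d₁ + b * d₂) * d₁ + (b * d₁ + (H - a) * d₂) * d₂ := by
    refine nonneg_of_mul_nonneg_right (a := H + a) ?_ ha
    nlinarith [sq_nonneg ((H + a) * d₁ + b * d₂), mul_nonneg (sub_nonneg.2 hz.le) (sq_nonneg d₂)]
  nlinarith [mul_nonneg ht.1.le hq]

end PoissonHessian

/-- A solution vanishing on the boundary is negative inside. -/
lemma PoissonHessian.neg_of_frontier (hΩo : IsOpen Ω) (hΩb : Bornology.IsBounded Ω)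
    (h : PoissonHessian (closure Ω) H v v₁ v₂ A B) (hH : 0 < H)
    (hbd : ∀ x ∈ frontier Ω, v x = 0) : ∀ x ∈ Ω, v x < 0 := by
  have hs : ∀ y ∈ Ω, closure Ω ∈ 𝓝 y := fun y hy =>
    mem_of_superset (hΩo.mem_nhds hy) subset_closure
  have key := pos_of_frontier_nonneg hΩo hΩb (f := fun x => 0 - v x)
    (continuousOn_const.sub h.continuousOn) (fun x hx => by simp [hbd x hx]) fun x hx hmin => by
      have c := fun x => hasFDerivAt_planeForm_const 0 x
      have := hmin.laplacian_nonneg (eventually_of_mem (hΩo.mem_nhds hx) fun y hy =>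
        (c y).planeForm_sub (h.hasFDerivAt (hs y hy)))
        ((c x).planeForm_sub (h.hasFDerivAt_fst (hs x hx)))
        ((c x).planeForm_sub (h.hasFDerivAt_snd (hs x hx)))
      linarith
  intro x hx
  simpa using key x hx

end MakarLimanov
/-- A segment starting in an open set and ending outside has a first exit point. -/
lemma IsOpen.exists_first_exit {Ω : Set (ℝ × ℝ)} (hΩo : IsOpen Ω) {x d : ℝ × ℝ} (hx : x ∈ Ω)
    (hd : x + d ∉ Ω) :
    ∃ t ∈ Ioc (0 : ℝ) 1, x + t • d ∈ frontier Ω ∧ ∀ r ∈ Ico (0 : ℝ) t, x + r • d ∈ Ω := by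
  have hcont : Continuous fun t : ℝ => x + t • d := by fun_prop
  obtain ⟨t, ⟨ht, htΩ⟩, hleast⟩ := (isCompact_Icc.inter_right (hΩo.isClosed_compl.preimage
    hcont)).exists_isLeast (s := Icc (0 : ℝ) 1 ∩ (fun t : ℝ => x + t • d) ⁻¹' Ωᶜ)
    ⟨1, by simp, by simpa using hd⟩
  have ht0 : 0 < t := ht.1.lt_of_ne fun h0 => htΩ (by simpa [← h0] using hx)
  have hlt : ∀ r ∈ Ico (0 : ℝ) t, x + r • d ∈ Ω := fun r hr => by
    by_contra hrΩ
    exact hr.2.not_ge (hleast ⟨⟨hr.1, hr.2.le.trans ht.2⟩, hrΩ⟩)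
  refine ⟨t, ⟨ht0, ht.2⟩, ?_, hlt⟩
  rw [hΩo.frontier_eq]
  refine ⟨mem_closure_of_tendsto (hcont.continuousWithinAt (s := Iio t)) ?_, htΩ⟩
  filter_upwards [Ioo_mem_nhdsLT ht0] with r hr using hlt r ⟨hr.1.le, hr.2⟩

/-- The Makar-Limanov function is nonnegative on the boundary of a convex domain. -/
lemma PoissonHessian.makarLimanov_nonneg_of_frontier {Ω : Set (ℝ × ℝ)} {H : ℝ}
    {v v₁ v₂ A B : ℝ × ℝ → ℝ} (h : PoissonHessian (closure Ω) H v v₁ v₂ A B) (hΩo : IsOpen Ω)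
    (hΩc : Convex ℝ Ω) (hΩne : Ω.Nonempty) (hneg : ∀ x ∈ Ω, v x < 0)
    (hbd : ∀ x ∈ frontier Ω, v x = 0) {x : ℝ × ℝ} (hx : x ∈ frontier Ω) :
    0 ≤ makarLimanov H v v₁ v₂ A B x := by
  have hxc : x ∈ closure Ω := frontier_subset_closure hx
  by_cases hgrad : v₁ x = 0 ∧ v₂ x = 0
  · simp [makarLimanov, hbd x hx, hgrad]
  have hpos : 0 < v₁ x ^ 2 + v₂ x ^ 2 := by
    by_contra! h0
    exact hgrad ⟨by nlinarith [sq_nonneg (v₁ x), sq_nonneg (v₂ x)],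
      by nlinarith [sq_nonneg (v₁ x), sq_nonneg (v₂ x)]⟩
  have hnonpos : ∀ z ∈ closure Ω, v z ≤ v x := fun z hz => by
    rw [hbd x hx]
    by_cases hzΩ : z ∈ Ω
    · exact (hneg z hzΩ).le
    · exact (hbd z (hΩo.frontier_eq ▸ ⟨hz, hzΩ⟩)).le
  have hle : ∀ z ∈ closure Ω, v₁ x * (z - x).1 + v₂ x * (z - x).2 ≤ 0 := fun z hz => by
    have hmax : IsMaxOn v (closure Ω) x := hnonpos
    simpa only [planeForm_apply] using hmax.localize.hasFDerivWithinAt_nonpos (h.hasGrad x hxc)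
      (sub_mem_posTangentConeAt_of_segment_subset (hΩc.closure.segment_subset hxc hz))
  have hlt : ∀ z ∈ Ω, v₁ x * (z - x).1 + v₂ x * (z - x).2 < 0 := fun z hz => by
    have hcont : Continuous fun t : ℝ => z + t • (v₁ x, v₂ x) := by fun_prop
    have hev : ∀ᶠ t in 𝓝 (0 : ℝ), z + t • (v₁ x, v₂ x) ∈ Ω :=
      hcont.tendsto 0 (by simpa using hΩo.mem_nhds hz)
    obtain ⟨t, htΩ, ht⟩ := ((hev.filter_mono nhdsWithin_le_nhds).and
      (self_mem_nhdsWithin (s := Ioi (0 : ℝ)))).exists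
    have := hle _ (subset_closure htΩ)
    have ht' : 0 < t := ht
    simp at this ⊢
    nlinarith [mul_pos ht' hpos]
  obtain ⟨y, hy⟩ := hΩne
  set n := y - x with hn
  have hg := hlt y hy
  set τ : ℝ × ℝ := (-v₂ x, v₁ x) with hτ
  set e : ℝ → ℝ × ℝ := fun σ => n + σ • (τ - n) with he
  have hchord : ∀ k : ℕ, ∃ σ ∈ Icc (0 : ℝ) 1, ∃ s ∈ Ioo (0 : ℝ) 1, ∃ r ∈ Ioo (0 : ℝ) 1,
      x + (s * (1 / ((k : ℝ) + 1))) • e σ ∈ closure Ω ∧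
      x + (r * (1 / ((k : ℝ) + 1))) • e σ ∈ closure Ω ∧
      v₁ (x + (s * (1 / ((k : ℝ) + 1))) • e σ) * (e σ).1
        + v₂ (x + (s * (1 / ((k : ℝ) + 1))) • e σ) * (e σ).2 = 0 ∧
      0 ≤ ((H + A (x + (r * (1 / ((k : ℝ) + 1))) • e σ)) * (e σ).1
        + B (x + (r * (1 / ((k : ℝ) + 1))) • e σ) * (e σ).2) * (e σ).1
        + (B (x + (r * (1 / ((k : ℝ) + 1))) • e σ) * (e σ).1
          + (H - A (x + (r * (1 / ((k : ℝ) + 1))) • e σ)) * (e σ).2) * (e σ).2 := by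
    intro k
    have ht : 0 < 1 / ((k : ℝ) + 1) := Nat.one_div_pos_of_nat
    have ht1 : 1 / ((k : ℝ) + 1) ≤ 1 := by
      rw [div_le_one (by positivity)]
      linarith [k.cast_nonneg (α := ℝ)]
    generalize 1 / ((k : ℝ) + 1) = t at ht ht1 ⊢
    have hin : x + t • n ∈ Ω := by
      have := hΩc.combo_closure_interior_mem_interior hxc (hΩo.interior_eq.symm ▸ hy)
        (sub_nonneg.2 ht1) ht (sub_add_cancel 1 t)
      rw [hΩo.interior_eq] at this
      convert this using 1
      rw [hn]
      module
    have hout : x + t • n + t • (τ - n) ∉ Ω := fun hΩ => by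
      have := hlt _ hΩ
      rw [show x + t • n + t • (τ - n) - x = t • τ by module] at this
      simp only [hτ, Prod.smul_mk, smul_eq_mul] at this
      nlinarith
    obtain ⟨σ, hσ, hσf, -⟩ := hΩo.exists_first_exit hin hout
    rw [show x + t • n + σ • t • (τ - n) = x + t • e σ by rw [he]; module] at hσf
    obtain ⟨s, hs, r, hr, hs', hr', e₁, e₂⟩ := h.exists_taylor hΩc.closure hxc
      (frontier_subset_closure hσf)
    refine ⟨σ, Ioc_subset_Icc_self hσ, s, hs, r, hr, by rwa [mul_smul], by rwa [mul_smul], ?_⟩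
    have hfirst := hle _ (frontier_subset_closure hσf)
    rw [add_sub_cancel_left] at hfirst
    rw [hbd _ hσf, hbd x hx, sub_zero] at e₁
    rw [← e₁] at e₂
    simp only [mul_smul]
    simp only [Prod.smul_fst, Prod.smul_snd, smul_eq_mul] at e₁ e₂ hfirst
    constructor
    · refine (mul_eq_zero.1 (?_ : t * _ = 0)).resolve_left ht.ne'
      linear_combination -e₁
    · refine nonneg_of_mul_nonneg_right (a := s * t ^ 2) ?_ (mul_pos hs.1 (pow_pos ht 2))
      linear_combination hfirst + e₂
  choose σ hσ s hs r hr hs' hr' e₁ e₂ using hchord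
  obtain ⟨σ₀, -, φ, hφ, hlim⟩ := isCompact_Icc.tendsto_subseq hσ
  have he_cont : Continuous e := by fun_prop
  have hetend : Tendsto (fun k => e (σ (φ k))) atTop (𝓝 (e σ₀)) :=
    (he_cont.tendsto σ₀).comp hlim
  have hpt : ∀ a : ℕ → ℝ, (∀ k, a k ∈ Ioo (0 : ℝ) 1) →
      (∀ k, x + (a k * (1 / ((k : ℝ) + 1))) • e (σ k) ∈ closure Ω) →
      Tendsto (fun k => x + (a (φ k) * (1 / ((φ k : ℝ) + 1))) • e (σ (φ k))) atTop
        (𝓝[closure Ω] x) := fun a ha hac => by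
    refine tendsto_nhdsWithin_iff.2 ⟨?_, Eventually.of_forall fun k => hac (φ k)⟩
    have h0 : Tendsto (fun k => a k * (1 / ((k : ℝ) + 1))) atTop (𝓝 0) :=
      squeeze_zero (fun k => mul_nonneg (ha k).1.le Nat.one_div_pos_of_nat.le)
        (fun k => mul_le_of_le_one_left Nat.one_div_pos_of_nat.le (ha k).2.le)
        tendsto_one_div_add_atTop_nhds_zero_nat
    simpa using ((h0.comp hφ.tendsto_atTop).smul hetend).const_add x
  have hps := hpt s hs hs'
  have hpr := hpt r hr hr'
  have hfst := (continuous_fst.tendsto _).comp hetend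
  have hsnd := (continuous_snd.tendsto _).comp hetend
  have l₁ : v₁ x * (e σ₀).1 + v₂ x * (e σ₀).2 = 0 :=
    tendsto_nhds_unique ((((h.continuousOn_fst x hxc).tendsto.comp hps).mul hfst).add
      (((h.continuousOn_snd x hxc).tendsto.comp hps).mul hsnd))
      (tendsto_const_nhds.congr fun k => (e₁ (φ k)).symm)
  have hAl := (h.continuousOn_A x hxc).tendsto.comp hpr
  have hBl := (h.continuousOn_B x hxc).tendsto.comp hpr
  have l₂ := ge_of_tendsto' ((((hAl.const_add H).mul hfst).add (hBl.mul hsnd)).mul hfst |>.add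
    (((hBl.mul hfst).add ((hAl.const_sub H).mul hsnd)).mul hsnd)) fun k => e₂ (φ k)
  have hσ₀ : σ₀ = 1 := by
    have : (1 - σ₀) * (v₁ x * n.1 + v₂ x * n.2) = 0 := by
      rw [← l₁]
      simp [he, hτ]
      ring
    linarith [(mul_eq_zero.1 this).resolve_right hg.ne]
  have heτ : e σ₀ = τ := by simp [he, hσ₀]
  rw [heτ] at l₂
  refine l₂.trans_eq ?_
  simp only [makarLimanov, hbd x hx, hτ]
  ring

namespace CauchyRiemannOn

variable {Ω : Set (ℝ × ℝ)} {A B α β γ δ : ℝ × ℝ → ℝ}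

/-- The holomorphic function with real part `A` and imaginary part `-B`. -/
lemma hasDerivAt (h : CauchyRiemannOn Ω A B α β) {z : ℂ} (hz : (z.re, z.im) ∈ Ω) :
    HasDerivAt (fun w : ℂ => (⟨A (w.re, w.im), -B (w.re, w.im)⟩ : ℂ))
      ⟨α (z.re, z.im), -β (z.re, z.im)⟩ z := by
  have hpair : HasFDerivAt (fun w : ℂ => (w.re, w.im)) (Complex.reCLM.prod Complex.imCLM) z :=
    (Complex.reCLM.prod Complex.imCLM).hasFDerivAt
  have hA := (h.re _ hz).comp z hpair
  have hB := ((h.im _ hz).comp z hpair).neg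
  have hAB := Complex.equivRealProdCLM.symm.toContinuousLinearMap.hasFDerivAt.comp z
    (hA.prodMk hB)
  rw [hasDerivAt_iff_hasFDerivAt]
  refine hasFDerivAt_of_restrictScalars ℝ (hAB.congr_of_eventuallyEq ?_) ?_
  · exact Eventually.of_forall fun w => by apply Complex.ext <;> simp
  · refine ContinuousLinearMap.ext fun u => ?_
    apply Complex.ext <;> simp <;> ring

/-- Either the derivative vanishes identically, or it vanishes to finite order at a given point:
then the derivative `α - iβ` is, near `p`, a power times a continuous nonvanishing function. -/
lemma eqOn_zero_or_exists_pow (h : CauchyRiemannOn Ω α β γ δ) (hΩo : IsOpen Ω)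
    (hΩc : Convex ℝ Ω) {p : ℝ × ℝ} (hp : p ∈ Ω) :
    (∀ x ∈ Ω, α x = 0 ∧ β x = 0) ∨
      ∃ (k : ℕ) (g : ℂ → ℂ), ContinuousAt g 0 ∧ g 0 ≠ 0 ∧ ∀ᶠ w in 𝓝 (0 : ℂ),
        (⟨α (p + (w.re, w.im)), -β (p + (w.re, w.im))⟩ : ℂ) = w ^ k * g w := by
  set f : ℂ → ℂ := fun w => ⟨α (w.re, w.im), -β (w.re, w.im)⟩ with hf
  set U : Set ℂ := Complex.equivRealProdCLM ⁻¹' Ω with hU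
  set z : ℂ := ⟨p.1, p.2⟩ with hz
  have hzU : z ∈ U := hp
  have hUo : IsOpen U := hΩo.preimage Complex.equivRealProdCLM.continuous
  have hUc : Convex ℝ U := hΩc.linear_preimage Complex.equivRealProdCLM.toLinearMap
  have han : AnalyticOnNhd ℂ f U :=
    DifferentiableOn.analyticOnNhd
      (fun w hw => (h.hasDerivAt hw).differentiableAt.differentiableWithinAt) hUo
  by_cases h0 : ∀ᶠ w in 𝓝 z, f w = 0
  · left
    intro x hx
    have := han.eqOn_zero_of_preconnected_of_eventuallyEq_zero hUc.isPreconnected hzU h0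
      (show (⟨x.1, x.2⟩ : ℂ) ∈ U from hx)
    simpa [hf, Complex.ext_iff] using this
  · right
    obtain ⟨k, g, hg, hg0, hfg⟩ := (han z hzU).exists_eventuallyEq_pow_smul_nonzero_iff.2 h0
    have hshift : Tendsto (fun w : ℂ => z + w) (𝓝 0) (𝓝 z) := by
      simpa using (continuous_const_add z).tendsto 0
    refine ⟨k, fun w => g (z + w), ?_, by simpa using hg0, ?_⟩
    · exact ContinuousAt.comp (f := fun w : ℂ => z + w) (by simpa using hg.continuousAt)
        (by fun_prop)
    · filter_upwards [hshift.eventually hfg] with w hw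
      simp only [hf, hz, smul_eq_mul, add_sub_cancel_left] at hw
      exact hw

end CauchyRiemannOn

section Nondegeneracy

variable {Ω : Set (ℝ × ℝ)} {H : ℝ} {v v₁ v₂ A B α β γ δ : ℝ × ℝ → ℝ}

/-- A function with zero derivative along a segment is constant along it. -/
lemma eq_of_line_deriv_zero {f f₁ f₂ : ℝ × ℝ → ℝ} {p e : ℝ × ℝ} {T : ℝ}
    (hf : ContinuousOn f (closure Ω)) (hmem : ∀ t ∈ Icc (0 : ℝ) T, p + t • e ∈ closure Ω)
    (hd : ∀ t ∈ Ico (0 : ℝ) T, HasFDerivAt f (planeForm (f₁ (p + t • e)) (f₂ (p + t • e)))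
      (p + t • e))
    (h0 : ∀ t ∈ Ico (0 : ℝ) T, f₁ (p + t • e) * e.1 + f₂ (p + t • e) * e.2 = 0) :
    ∀ t ∈ Icc (0 : ℝ) T, f (p + t • e) = f p := by
  have hline : Continuous fun t : ℝ => p + t • e := by fun_prop
  simpa using constant_of_has_deriv_right_zero (f := fun t : ℝ => f (p + t • e))
    (hf.comp hline.continuousOn hmem)
    fun t ht => ((hd t ht).hasDerivAt_line.congr_deriv (h0 t ht)).hasDerivWithinAt

/-- If the Hessian is constant, it is nondegenerate at critical points. -/
lemma PoissonHessian.det_ne_zero_of_constant (h : PoissonHessian (closure Ω) H v v₁ v₂ A B)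
    (hΩo : IsOpen Ω) (hΩb : Bornology.IsBounded Ω) (hH : 0 < H)
    (hneg : ∀ x ∈ Ω, v x < 0) (hbd : ∀ x ∈ frontier Ω, v x = 0)
    (hAB : CauchyRiemannOn Ω A B α β) (h0 : ∀ x ∈ Ω, α x = 0 ∧ β x = 0)
    {p : ℝ × ℝ} (hp : p ∈ Ω) (hp₁ : v₁ p = 0) (hp₂ : v₂ p = 0) :
    A p ^ 2 + B p ^ 2 ≠ H ^ 2 := by
  intro hdet
  obtain ⟨e, he, hk₁, hk₂⟩ : ∃ e : ℝ × ℝ, e ≠ 0 ∧ (H + A p) * e.1 + B p * e.2 = 0 ∧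
      B p * e.1 + (H - A p) * e.2 = 0 := by
    by_cases hA : H - A p = 0
    · exact ⟨(-B p, H + A p), fun h => by simp [Prod.ext_iff] at h; linarith, by simp; ring,
        by simp; linarith⟩
    · exact ⟨(H - A p, -B p), fun h => hA (by simp [Prod.ext_iff] at h; exact h.1),
        by simp; linarith, by simp; ring⟩
  obtain ⟨R, hR⟩ : ∃ R : ℝ, p + R • e ∉ Ω := by
    obtain ⟨C, hC⟩ := hΩb.exists_norm_le
    refine ⟨(C + ‖p‖ + 1) / ‖e‖, fun hmem => ?_⟩
    have h₁ := hC _ hmem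
    have h₂ := norm_sub_le (p + ((C + ‖p‖ + 1) / ‖e‖) • e) p
    have hC0 : 0 ≤ C := (norm_nonneg _).trans h₁
    rw [add_sub_cancel_left, norm_smul, Real.norm_of_nonneg (by positivity),
      div_mul_cancel₀ _ (norm_ne_zero_iff.2 he)] at h₂
    linarith
  obtain ⟨T, hT, hTf, hin⟩ := hΩo.exists_first_exit hp hR
  have hs : ∀ t ∈ Ico (0 : ℝ) T, closure Ω ∈ 𝓝 (p + t • R • e) := fun t ht =>
    mem_of_superset (hΩo.mem_nhds (hin t ht)) subset_closure
  have hmem : ∀ t ∈ Icc (0 : ℝ) T, p + t • R • e ∈ closure Ω := fun t ht => by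
    rcases ht.2.eq_or_lt with rfl | hlt
    · exact frontier_subset_closure hTf
    · exact subset_closure (hin t ⟨ht.1, hlt⟩)
  have cA := eq_of_line_deriv_zero h.continuousOn_A hmem (fun t ht => hAB.re _ (hin t ht))
    fun t ht => by simp [h0 _ (hin t ht)]
  have cB := eq_of_line_deriv_zero (f₂ := fun x => -α x) h.continuousOn_B hmem
    (fun t ht => hAB.im _ (hin t ht)) fun t ht => by simp [h0 _ (hin t ht)]
  have c₁ := eq_of_line_deriv_zero (f₁ := fun x => H + A x) h.continuousOn_fst hmem
    (fun t ht => h.hasFDerivAt_fst (hs t ht)) fun t ht => by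
      rw [cA t (Ico_subset_Icc_self ht), cB t (Ico_subset_Icc_self ht)]
      simp only [Prod.smul_fst, Prod.smul_snd, smul_eq_mul]
      linear_combination R * hk₁
  have c₂ := eq_of_line_deriv_zero (f₂ := fun x => H - A x) h.continuousOn_snd hmem
    (fun t ht => h.hasFDerivAt_snd (hs t ht)) fun t ht => by
      rw [cA t (Ico_subset_Icc_self ht), cB t (Ico_subset_Icc_self ht)]
      simp only [Prod.smul_fst, Prod.smul_snd, smul_eq_mul]
      linear_combination R * hk₂
  have cv := eq_of_line_deriv_zero h.continuousOn hmem (fun t ht => h.hasFDerivAt (hs t ht))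
    fun t ht => by
      simp [c₁ t (Ico_subset_Icc_self ht), c₂ t (Ico_subset_Icc_self ht), hp₁, hp₂]
  have := cv T ⟨hT.1.le, le_rfl⟩
  rw [hbd _ hTf] at this
  exact (hneg p hp).ne this.symm

/-- If the Makar-Limanov function is nonnegative, it does not vanish at critical points. -/
lemma PoissonHessian.det_ne_zero (h : PoissonHessian (closure Ω) H v v₁ v₂ A B)
    (hΩo : IsOpen Ω) (hΩb : Bornology.IsBounded Ω) (hΩc : Convex ℝ Ω) (hH : 0 < H)
    (hneg : ∀ x ∈ Ω, v x < 0) (hbd : ∀ x ∈ frontier Ω, v x = 0)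
    (hF : ∀ x ∈ Ω, 0 ≤ makarLimanov H v v₁ v₂ A B x)
    (hAB : CauchyRiemannOn Ω A B α β) (hαβ : CauchyRiemannOn Ω α β γ δ)
    {p : ℝ × ℝ} (hp : p ∈ Ω) (hp₁ : v₁ p = 0) (hp₂ : v₂ p = 0) :
    A p ^ 2 + B p ^ 2 ≠ H ^ 2 := by
  rcases hαβ.eqOn_zero_or_exists_pow hΩo hΩc hp with h0 | ⟨k, g, hg, hg0, hfg⟩
  · exact h.det_ne_zero_of_constant hΩo hΩb hH hneg hbd hAB h0 hp hp₁ hp₂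
  intro hdet
  have hs : ∀ y ∈ Ω, closure Ω ∈ 𝓝 y := fun y hy =>
    mem_of_superset (hΩo.mem_nhds hy) subset_closure
  set X : ℝ × ℝ → ℂ := fun x => ⟨4 * (v x * A x) - v₁ x * v₁ x + v₂ x * v₂ x,
    4 * (v x * B x) - 2 * (v₁ x * v₂ x)⟩ with hX
  have hXp : X p ≠ 0 := fun h0 => by
    simp only [hX, hp₁, hp₂, Complex.ext_iff, Complex.zero_re, Complex.zero_im, mul_zero,
      sub_zero, add_zero, mul_eq_zero, OfNat.ofNat_ne_zero, false_or, (hneg p hp).ne] at h0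
    rw [h0.1, h0.2] at hdet
    nlinarith
  obtain ⟨w, hw⟩ := IsAlgClosed.exists_pow_nat_eq (-(g 0 * X p)⁻¹) k.succ_pos
  have hline : Continuous fun t : ℝ => p + t • (w.re, w.im) := by fun_prop
  have hline0 : Tendsto (fun t : ℝ => p + t • (w.re, w.im)) (𝓝 0) (𝓝 p) := by
    simpa using hline.tendsto 0
  have htw : Tendsto (fun t : ℝ => (t : ℂ) * w) (𝓝 0) (𝓝 0) := by
    have : Continuous fun t : ℝ => (t : ℂ) * w := by fun_prop
    simpa using this.tendsto 0
  have hXc : ContinuousAt X p := by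
    have hp' := hs p hp
    have := h.continuousOn.continuousAt hp'
    have := h.continuousOn_fst.continuousAt hp'
    have := h.continuousOn_snd.continuousAt hp'
    have := h.continuousOn_A.continuousAt hp'
    have := h.continuousOn_B.continuousAt hp'
    refine Complex.equivRealProdCLM.symm.continuous.continuousAt.comp (f := fun x =>
      (4 * (v x * A x) - v₁ x * v₁ x + v₂ x * v₂ x, 4 * (v x * B x) - 2 * (v₁ x * v₂ x))) ?_
      |>.congr ?_
    · fun_prop
    · exact Eventually.of_forall fun x => by apply Complex.ext <;> simp [hX]
  have hlim : Tendsto (fun t : ℝ => (w ^ (k + 1) * (g (t * w) * X (p + t • (w.re, w.im)))).re)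
      (𝓝 0) (𝓝 (-1)) := by
    have := ((hg.tendsto.comp htw).mul (hXc.tendsto.comp hline0)).const_mul (w ^ (k + 1))
    rw [hw, neg_mul, inv_mul_cancel₀ (mul_ne_zero hg0 hXp)] at this
    simpa [Function.comp_def, hw] using (Complex.continuous_re.tendsto _).comp this
  obtain ⟨ε, hε, hev⟩ := Metric.eventually_nhds_iff_ball.1
    (((hline0.eventually (hΩo.mem_nhds hp)).and (htw.eventually hfg)).and
      (hlim.eventually_lt_const (neg_one_lt_zero (R := ℝ))))
  have hev' : ∀ t ∈ Icc 0 (ε / 2), t ∈ Metric.ball (0 : ℝ) ε := fun t ht => by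
    rw [Metric.mem_ball, Real.dist_0_eq_abs, abs_of_nonneg ht.1]
    linarith [ht.2]
  have hderiv : ∀ t ∈ Icc 0 (ε / 2), HasDerivAt
      (fun t : ℝ => makarLimanov H v v₁ v₂ A B (p + t • (w.re, w.im)))
      (t ^ k * (w ^ (k + 1) * (g (t * w) * X (p + t • (w.re, w.im)))).re) t := fun t ht => by
    obtain ⟨⟨hΩt, hgt⟩, -⟩ := hev t (hev' t ht)
    refine ((h.hasFDerivAt_makarLimanov (hs _ hΩt) (hAB.re _ hΩt)
      (hAB.im _ hΩt)).hasDerivAt_line).congr_deriv ?_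
    have hpt : p + t • (w.re, w.im) = p + (((t : ℂ) * w).re, ((t : ℂ) * w).im) := by simp
    rw [← hpt] at hgt
    have hcomplex : ((t ^ k : ℝ) : ℂ) * (w ^ (k + 1) * (g (t * w) * X (p + t • (w.re, w.im))))
        = w * (⟨α (p + t • (w.re, w.im)), -β (p + t • (w.re, w.im))⟩
          * X (p + t • (w.re, w.im))) := by
      rw [hgt]
      push_cast
      ring
    have hre := congrArg Complex.re hcomplex
    rw [Complex.re_ofReal_mul] at hre
    rw [hre]
    simp [hX]
    ring
  have hanti : StrictAntiOn
      (fun t : ℝ => makarLimanov H v v₁ v₂ A B (p + t • (w.re, w.im))) (Icc 0 (ε / 2)) :=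
    strictAntiOn_of_deriv_neg (convex_Icc _ _)
      (fun t ht => (hderiv t ht).continuousAt.continuousWithinAt) fun t ht => by
        rw [interior_Icc] at ht
        rw [(hderiv t (Ioo_subset_Icc_self ht)).deriv]
        exact mul_neg_of_pos_of_neg (pow_pos ht.1 k) (hev t (hev' t (Ioo_subset_Icc_self ht))).2
  have hlast := hanti (left_mem_Icc.2 (half_pos hε).le) (right_mem_Icc.2 (half_pos hε).le)
    (half_pos hε)
  have hp0 : makarLimanov H v v₁ v₂ A B p = 0 := by
    simp only [makarLimanov, hp₁, hp₂]
    linear_combination 2 * v p * hdet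
  simp only [zero_smul, add_zero, hp0] at hlast
  exact hlast.not_ge (hF _ (hev _ (hev' _ (right_mem_Icc.2 (half_pos hε).le))).1.1)

/-- The Makar-Limanov function of a solution in a convex domain is nonnegative. -/
lemma PoissonHessian.makarLimanov_nonneg (h : PoissonHessian (closure Ω) H v v₁ v₂ A B)
    (hΩo : IsOpen Ω) (hΩb : Bornology.IsBounded Ω) (hΩc : Convex ℝ Ω) (hH : 0 < H)
    (hneg : ∀ x ∈ Ω, v x < 0) (hbd : ∀ x ∈ frontier Ω, v x = 0)
    (hAB : CauchyRiemannOn Ω A B α β) (hαβ : CauchyRiemannOn Ω α β γ δ) {x : ℝ × ℝ}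
    (hx : x ∈ Ω) : 0 ≤ makarLimanov H v v₁ v₂ A B x := by
  have key : ∀ ε > 0, 0 < makarLimanov H v v₁ v₂ A B x - ε * v x := fun ε hε =>
    pos_of_frontier_nonneg hΩo hΩb (f := fun y => makarLimanov H v v₁ v₂ A B y - ε * v y)
      (h.continuousOn_makarLimanov.sub (continuousOn_const.mul h.continuousOn))
      (fun y hy => by
        simpa [hbd y hy] using h.makarLimanov_nonneg_of_frontier hΩo hΩc ⟨x, hx⟩ hneg hbd hy)
      (fun y hy => h.not_isLocalMin_makarLimanov hΩo subset_closure hAB hαβ hH hy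
        (hneg y hy).le hε) x hx
  refine le_of_forall_pos_lt_add fun ε hε => ?_
  have := key (ε / -v x) (div_pos hε (neg_pos.2 (hneg x hx)))
  rwa [div_neg, neg_mul, div_mul_cancel₀ _ (hneg x hx).ne, sub_neg_eq_add] at this

end Nondegeneracy

lemma HasFDerivAt.pd1_eq {f : ℝ × ℝ → ℝ} {a b : ℝ} {x : ℝ × ℝ}
    (h : HasFDerivAt f (planeForm a b) x) : pd1 f x = a := by
  simp [pd1, h.fderiv]

lemma HasFDerivAt.pd2_eq {f : ℝ × ℝ → ℝ} {a b : ℝ} {x : ℝ × ℝ}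
    (h : HasFDerivAt f (planeForm a b) x) : pd2 f x = b := by
  simp [pd2, h.fderiv]

/-- A smooth solution of `Δv = 2H` has a trace-constant Hessian with holomorphic entries. -/
lemma exists_poissonHessian {Ω : Set (ℝ × ℝ)} (hΩo : IsOpen Ω) (hΩc : Convex ℝ Ω)
    (hΩne : Ω.Nonempty) {H : ℝ} {v : ℝ × ℝ → ℝ} (hsmooth : ContDiffOn ℝ (⊤ : ℕ∞) v (closure Ω))
    (heq : ∀ x ∈ Ω, pd1 (pd1 v) x + pd2 (pd2 v) x = 2 * H) :
    ∃ v₁ v₂ A B α β γ δ : ℝ × ℝ → ℝ, PoissonHessian (closure Ω) H v v₁ v₂ A B ∧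
      CauchyRiemannOn Ω A B α β ∧ CauchyRiemannOn Ω α β γ δ := by
  have hs : ∀ y ∈ Ω, closure Ω ∈ 𝓝 y := fun y hy =>
    mem_of_superset (hΩo.mem_nhds hy) subset_closure
  have hu : UniqueDiffOn ℝ (closure Ω) := uniqueDiffOn_convex hΩc.closure
    (hΩne.mono (interior_maximal subset_closure hΩo))
  have up : ∀ {f f₁ f₂ : ℝ × ℝ → ℝ}, (∀ y ∈ closure Ω,
      HasFDerivWithinAt f (planeForm (f₁ y) (f₂ y)) (closure Ω) y) →
      ∀ y ∈ Ω, HasFDerivAt f (planeForm (f₁ y) (f₂ y)) y := fun hf y hy =>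
    (hf y (subset_closure hy)).hasFDerivAt (hs y hy)
  have ev : ∀ {P : ℝ × ℝ → Prop}, (∀ y ∈ Ω, P y) → ∀ y ∈ Ω, ∀ᶠ z in 𝓝 y, P z :=
    fun hP y hy => eventually_of_mem (hΩo.mem_nhds hy) hP
  obtain ⟨v₁, v₂, s₁, s₂, hv⟩ := hsmooth.exists_partials hu
  obtain ⟨a, b, sa, sb, hv₁⟩ := s₁.exists_partials hu
  obtain ⟨b', c, sb', sc, hv₂⟩ := s₂.exists_partials hu
  obtain ⟨α, β, sα, sβ, ha⟩ := sa.exists_partials hu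
  obtain ⟨b₁, b₂, -, -, hb⟩ := sb.exists_partials hu
  obtain ⟨γ, δ, -, -, hα⟩ := sα.exists_partials hu
  obtain ⟨β₁, β₂, -, -, hβ⟩ := sβ.exists_partials hu
  have hbb' : EqOn b b' Ω := fun y hy =>
    mixed_partials_eq (ev (up hv) y hy) (up hv₁ y hy) (up hv₂ y hy)
  have hc : EqOn c (fun y => 2 * H - a y) Ω := fun y hy => by
    have h₁ : pd1 (pd1 v) y = a y := ((up hv₁ y hy).congr_of_eventuallyEq
      (ev (fun z hz => (up hv z hz).pd1_eq) y hy)).pd1_eq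
    have h₂ : pd2 (pd2 v) y = c y := ((up hv₂ y hy).congr_of_eventuallyEq
      (ev (fun z hz => (up hv z hz).pd2_eq) y hy)).pd2_eq
    have := heq y hy
    rw [h₁, h₂] at this
    linarith
  have hbb'c : EqOn b b' (closure Ω) :=
    hbb'.of_subset_closure sb.continuousOn sb'.continuousOn subset_closure le_rfl
  have hcc : EqOn c (fun y => 2 * H - a y) (closure Ω) :=
    hc.of_subset_closure sc.continuousOn (continuousOn_const.sub sa.continuousOn) subset_closure
      le_rfl
  have hA : ∀ y ∈ Ω, HasFDerivAt (fun y => a y - H) (planeForm (α y) (β y)) y := fun y hy =>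
    ((up ha y hy).planeForm_sub (hasFDerivAt_planeForm_const H y)).planeForm_congr (by ring)
      (by ring)
  have hb₁ : ∀ y ∈ Ω, b₁ y = β y := fun y hy =>
    (mixed_partials_eq (ev (up hv₁) y hy) (up ha y hy) (up hb y hy)).symm
  have hb₂ : ∀ y ∈ Ω, b₂ y = -α y := fun y hy => by
    have h₁ := (up hb y hy).congr_of_eventuallyEq (ev (fun z hz => (hbb' hz).symm) y hy)
    have h₂ := ((hasFDerivAt_planeForm_const (2 * H) y).planeForm_sub
      (up ha y hy)).congr_of_eventuallyEq (ev (fun z hz => hc hz) y hy)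
    rw [mixed_partials_eq (ev (up hv₂) y hy) h₁ h₂, zero_sub]
  have hB : ∀ y ∈ Ω, HasFDerivAt b (planeForm (β y) (-α y)) y := fun y hy =>
    (up hb y hy).planeForm_congr (hb₁ y hy) (hb₂ y hy)
  have hδ : ∀ y ∈ Ω, β₁ y = δ y := fun y hy =>
    (mixed_partials_eq (ev (up ha) y hy) (up hα y hy) (up hβ y hy)).symm
  have hγ : ∀ y ∈ Ω, β₂ y = -γ y := fun y hy =>
    (mixed_partials_eq (f₂ := fun y => -α y) (ev hB y hy) (up hβ y hy)
      (((hasFDerivAt_planeForm_const 0 y).planeForm_sub (up hα y hy)).congr_of_eventuallyEq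
        (Eventually.of_forall fun z => by simp))).trans (zero_sub _)
  refine ⟨v₁, v₂, fun y => a y - H, b, α, β, γ, δ, ⟨hv, fun y hy => ?_, fun y hy => ?_,
    sa.continuousOn.sub continuousOn_const, sb.continuousOn⟩, ⟨hA, hB⟩, ⟨up hα, fun y hy =>
    (up hβ y hy).planeForm_congr (hδ y hy) (hγ y hy)⟩⟩
  · simpa using hv₁ y hy
  · have := hv₂ y hy
    have hcy : c y = H - (a y - H) := (hcc hy).trans (by ring)
    rwa [← hbb'c hy, hcy] at this


/-- For a solution of `Δv = 2H`, `H > 0`, vanishing on the boundary of a bounded open convex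
domain, every critical point has strictly positive Hessian determinant; in particular every
critical point is a local minimum point (the graph has negative Gaussian curvature there). -/
theorem poisson_critical_points_are_minima
    (Ω : Set (ℝ × ℝ)) (hΩo : IsOpen Ω) (hΩb : Bornology.IsBounded Ω)
    (hΩc : Convex ℝ Ω) (hΩne : Ω.Nonempty)
    (H : ℝ) (hH : 0 < H)
    (v : ℝ × ℝ → ℝ) (hsmooth : ContDiffOn ℝ (⊤ : ℕ∞) v (closure Ω))
    (heq : ∀ x ∈ Ω, pd1 (pd1 v) x + pd2 (pd2 v) x = 2 * H)
    (hbd : ∀ x ∈ frontier Ω, v x = 0) :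
    ∀ p ∈ Ω, (pd1 v p = 0 ∧ pd2 v p = 0) →
      0 < pd1 (pd1 v) p * pd2 (pd2 v) p - (pd2 (pd1 v) p)^2 ∧ IsLocalMin v p := by
  obtain ⟨v₁, v₂, A, B, α, β, γ, δ, h, hAB, hαβ⟩ :=
    exists_poissonHessian hΩo hΩc hΩne hsmooth heq
  rintro p hp ⟨hp₁, hp₂⟩
  have hs : ∀ y ∈ Ω, closure Ω ∈ 𝓝 y := fun y hy =>
    mem_of_superset (hΩo.mem_nhds hy) subset_closure
  have e₁ : pd1 v =ᶠ[𝓝 p] v₁ :=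
    eventually_of_mem (hΩo.mem_nhds hp) fun y hy => (h.hasFDerivAt (hs y hy)).pd1_eq
  have e₂ : pd2 v =ᶠ[𝓝 p] v₂ :=
    eventually_of_mem (hΩo.mem_nhds hp) fun y hy => (h.hasFDerivAt (hs y hy)).pd2_eq
  have h₁ := (h.hasFDerivAt_fst (hs p hp)).congr_of_eventuallyEq e₁
  have h₂ := (h.hasFDerivAt_snd (hs p hp)).congr_of_eventuallyEq e₂
  rw [e₁.eq_of_nhds] at hp₁
  rw [e₂.eq_of_nhds] at hp₂
  have hneg := h.neg_of_frontier hΩo hΩb hH hbd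
  have hF : ∀ x ∈ Ω, 0 ≤ makarLimanov H v v₁ v₂ A B x := fun x hx =>
    h.makarLimanov_nonneg hΩo hΩb hΩc hH hneg hbd hAB hαβ hx
  have hne := h.det_ne_zero hΩo hΩb hΩc hH hneg hbd hF hAB hαβ hp hp₁ hp₂
  have hdet : A p ^ 2 + B p ^ 2 < H ^ 2 := by
    refine lt_of_le_of_ne ?_ hne
    have hFp := hF p hp
    simp only [makarLimanov, hp₁, hp₂] at hFp
    nlinarith [hneg p hp]
  refine ⟨?_, h.isLocalMin hΩc.closure (hs p hp) hH hp₁ hp₂ hdet⟩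
  rw [h₁.pd1_eq, h₁.pd2_eq, h₂.pd2_eq]
  nlinarith
end
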